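/- arXiv:math/0102101 — 6 statements merged into one kernel-verified Lean document; each statement's English description precedes it below -/
import Mathlib

section
/- Let K be a field of characteristic p and let G be a finite nonabelian powerful p-group (i.e., G/G^p is abelian if p is odd, and G/G^4 is abelian if p = 2). Then the group algebra KG does not have a filtered multiplicative K-basis. -/
/-- `B` is a *filtered multiplicative `K`-basis* of the `K`-algebra `A`:
(0) `B` is a `K`-basis of `A` (linearly independent and spanning);
(1) the product of two elements of `B` is either `0` or again an element of `B`;
(2) `B ∩ rad(A)` is a `K`-basis of the Jacobson radical `rad(A)` of `A`. -/
def IsFilteredMultiplicativeBasis (K : Type*) {A : Type*} [Field K] [Ring A] [Algebra K A]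
    (B : Set A) : Prop :=
  LinearIndependent K ((↑) : B → A) ∧
  Submodule.span K B = ⊤ ∧
  (∀ b₁ ∈ B, ∀ b₂ ∈ B, b₁ * b₂ = 0 ∨ b₁ * b₂ ∈ B) ∧
  LinearIndependent K ((↑) : ↥(B ∩ (((⊥ : Ideal A).jacobson : Ideal A) : Set A)) → A) ∧
  Submodule.span K (B ∩ (((⊥ : Ideal A).jacobson : Ideal A) : Set A)) =
    Submodule.restrictScalars K ((⊥ : Ideal A).jacobson)

section FixedVector

variable {p : ℕ} [Fact p.Prime] {G : Type*} [Group G] [Finite G]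

/-- A nonzero representation over `ZMod p` of a finite `p`-group has a nonzero invariant vector. -/
theorem IsPGroup.exists_ne_zero_forall_apply_eq (hG : IsPGroup p G) {V : Type*} [AddCommGroup V]
    [Module (ZMod p) V] (ρ : Representation (ZMod p) G V) {v : V} (hv : v ≠ 0) :
    ∃ w : V, w ≠ 0 ∧ ∀ g, ρ g w = w := by
  set W : Submodule (ZMod p) V := Submodule.span (ZMod p) (Set.range fun g => ρ g v) with hW
  have hmem : ∀ g, ∀ w ∈ W, ρ g w ∈ W := by
    intro g w hw
    induction hw using Submodule.span_induction with
    | mem x hx =>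
      obtain ⟨h, rfl⟩ := hx
      exact Submodule.subset_span ⟨g * h, by simp⟩
    | zero => simp
    | add x y _ _ hx hy => simpa using W.add_mem hx hy
    | smul c x _ hx => simpa using W.smul_mem c hx
  have hvW : v ∈ W := Submodule.subset_span ⟨1, by simp⟩
  have : FiniteDimensional (ZMod p) W := FiniteDimensional.span_of_finite _ (Set.finite_range _)
  have : Finite W := Module.finite_of_finite (ZMod p)
  let _ : MulAction G W :=
    { smul := fun g w => ⟨ρ g w, hmem g w w.2⟩
      one_smul := fun w => Subtype.ext (by change ρ 1 (w : V) = w; simp)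
      mul_smul := fun g h w => Subtype.ext (by
        change ρ (g * h) (w : V) = ρ g (ρ h (w : V)); simp) }
  have : Nontrivial W := ⟨⟨v, hvW⟩, 0, fun h => hv (congrArg Subtype.val h)⟩
  have hdvd : p ∣ Nat.card W := by
    rw [Module.natCard_eq_pow_finrank (K := ZMod p) (V := W), Nat.card_zmod]
    exact dvd_pow_self _ Module.finrank_pos.ne'
  have h0 : (0 : W) ∈ MulAction.fixedPoints G W := fun g =>
    Subtype.ext (by change ρ g (0 : V) = 0; simp)
  obtain ⟨w, hw, hne⟩ := hG.exists_fixed_point_of_prime_dvd_card_of_fixed_point W hdvd h0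
  exact ⟨w, fun h => hne (Subtype.ext h.symm), fun g => congrArg Subtype.val (hw g)⟩

end FixedVector

namespace MonoidAlgebra

section Augmentation

variable (K : Type*) [Field K] (G : Type*) [Group G]

/-- The augmentation map of a group algebra. -/
noncomputable def augmentation : MonoidAlgebra K G →ₐ[K] K :=
  MonoidAlgebra.lift K K G 1

/-- The augmentation ideal of a group algebra, as a subspace. -/
noncomputable def augmentationSubmodule : Submodule K (MonoidAlgebra K G) :=
  LinearMap.ker (augmentation K G).toLinearMap

variable {K G}

@[simp]
theorem augmentation_single (g : G) (r : K) : augmentation K G (single g r) = r := by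
  simp [augmentation]

theorem mem_augmentationSubmodule {a : MonoidAlgebra K G} :
    a ∈ augmentationSubmodule K G ↔ augmentation K G a = 0 := Iff.rfl

theorem single_sub_one_mem_augmentationSubmodule (g : G) :
    (single g 1 - 1 : MonoidAlgebra K G) ∈ augmentationSubmodule K G := by
  simp [mem_augmentationSubmodule]

theorem sub_smul_one_mem_augmentationSubmodule (a : MonoidAlgebra K G) :
    a - augmentation K G a • (1 : MonoidAlgebra K G) ∈ augmentationSubmodule K G := by
  simp [mem_augmentationSubmodule]

theorem induction_single_one {P : MonoidAlgebra K G → Prop} (a : MonoidAlgebra K G)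
    (single_one : ∀ g, P (single g 1)) (zero : P 0) (add : ∀ x y, P x → P y → P (x + y))
    (smul : ∀ (c : K) x, P x → P (c • x)) : P a := by
  have ha : a ∈ Submodule.span K (Set.range fun g : G => (single g 1 : MonoidAlgebra K G)) := by
    have h := (MonoidAlgebra.basis G K).mem_span a
    exact h
  induction ha using Submodule.span_induction with
  | mem x hx => obtain ⟨g, rfl⟩ := hx; exact single_one g
  | zero => exact zero
  | add x y _ _ hx hy => exact add x y hx hy
  | smul c x _ hx => exact smul c x hx

theorem jacobson_bot_le_ker_augmentation :
    (⊥ : Ideal (MonoidAlgebra K G)).jacobson ≤ RingHom.ker (augmentation K G) := by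
  have hsurj : Function.Surjective (augmentation K G) := fun r => ⟨single 1 r, by simp⟩
  exact sInf_le ⟨bot_le, RingHom.ker_isMaximal_of_surjective _ hsurj⟩

theorem mul_sub_augmentation_smul_mem {M : Ideal (MonoidAlgebra K G)} {x : MonoidAlgebra K G}
    (h : ∀ g, single g 1 * x - x ∈ M) (a : MonoidAlgebra K G) :
    a * x - augmentation K G a • x ∈ M := by
  induction a using induction_single_one with
  | single_one g => simpa using h g
  | zero => simp
  | add a b ha hb =>
    convert M.add_mem ha hb using 1
    simp only [add_mul, map_add, add_smul]; abel
  | smul c a ha =>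
    convert! (M.restrictScalars K).smul_mem c ha using 1
    simp [smul_sub, mul_smul]

theorem ker_augmentation_le_jacobson_bot [Finite G] {p : ℕ} [Fact p.Prime] [CharP K p]
    (hG : IsPGroup p G) :
    RingHom.ker (augmentation K G) ≤ (⊥ : Ideal (MonoidAlgebra K G)).jacobson := by
  refine le_sInf fun M hM a ha => ?_
  have hmax : M.IsMaximal := hM.2
  let _ := ZMod.algebra K p
  let _ : Module (ZMod p) (MonoidAlgebra K G ⧸ M) := Module.compHom _ (algebraMap (ZMod p) K)
  let ρ : Representation (ZMod p) G (MonoidAlgebra K G ⧸ M) :=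
    { toFun := fun g =>
        { toFun := fun x => (single g 1 : MonoidAlgebra K G) • x
          map_add' := smul_add _
          map_smul' := fun c x => smul_comm _ (algebraMap (ZMod p) K c) x }
      map_one' := LinearMap.ext fun x => one_smul (MonoidAlgebra K G) x
      map_mul' := fun g h => LinearMap.ext fun x => by
        change (single (g * h) 1 : MonoidAlgebra K G) • x =
          (single g 1 : MonoidAlgebra K G) • (single h 1 : MonoidAlgebra K G) • x
        rw [smul_smul, single_mul_single, one_mul] }
  have h1 : (Submodule.Quotient.mk 1 : MonoidAlgebra K G ⧸ M) ≠ 0 := fun h =>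
    hmax.ne_top ((Ideal.eq_top_iff_one _).2 ((Submodule.Quotient.mk_eq_zero M).1 h))
  obtain ⟨w, hw, hfix⟩ := hG.exists_ne_zero_forall_apply_eq ρ h1
  obtain ⟨x, rfl⟩ := Submodule.Quotient.mk_surjective M w
  have hx : x ∉ M := fun h => hw ((Submodule.Quotient.mk_eq_zero M).2 h)
  have hx' : ∀ g, single g 1 * x - x ∈ M := fun g =>
    (Submodule.Quotient.eq M).1 (hfix g)
  obtain ⟨y, i, hi, hy⟩ := hmax.exists_inv hx
  have key := mul_sub_augmentation_smul_mem hx' (a * y)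
  rw [RingHom.mem_ker] at ha
  rw [map_mul, ha, zero_mul, zero_smul, sub_zero] at key
  have : a = a * y * x + a * i := by rw [mul_assoc, ← mul_add, hy, mul_one]
  rw [this]
  exact M.add_mem key (M.mul_mem_left _ hi)

theorem restrictScalars_jacobson_bot [Finite G] {p : ℕ} [Fact p.Prime] [CharP K p]
    (hG : IsPGroup p G) :
    (⊥ : Ideal (MonoidAlgebra K G)).jacobson.restrictScalars K = augmentationSubmodule K G := by
  ext a
  exact ⟨fun h => jacobson_bot_le_ker_augmentation h,
    fun h => ker_augmentation_le_jacobson_bot hG h⟩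

theorem isNilpotent_augmentationSubmodule [Finite G] {p : ℕ} [Fact p.Prime] [CharP K p]
    (hG : IsPGroup p G) : IsNilpotent (augmentationSubmodule K G) := by
  have : IsArtinianRing (MonoidAlgebra K G) := IsArtinianRing.of_finite K _
  obtain ⟨n, hn⟩ := IsArtinianRing.isNilpotent_jacobson_bot (R := MonoidAlgebra K G)
  have hle : ∀ m, augmentationSubmodule K G ^ m ≤
      ((⊥ : Ideal (MonoidAlgebra K G)).jacobson ^ m).restrictScalars K := by
    intro m
    induction m with
    | zero =>
      intro x _
      rw [Submodule.pow_zero, Ideal.one_eq_top]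
      trivial
    | succ m ih =>
      rw [pow_succ, Submodule.pow_succ, Submodule.mul_le]
      intro a ha b hb
      rw [← restrictScalars_jacobson_bot hG] at hb
      exact Ideal.mul_mem_mul (ih ha) hb
  refine ⟨n, le_bot_iff.1 ((hle n).trans ?_)⟩
  rw [hn]
  exact le_rfl

theorem augmentationSubmodule_pow_le {m n : ℕ} (hmn : m ≤ n) (hm : m ≠ 0) :
    augmentationSubmodule K G ^ n ≤ augmentationSubmodule K G ^ m := by
  have hmul : augmentationSubmodule K G * augmentationSubmodule K G ≤
      augmentationSubmodule K G := Submodule.mul_le.2 fun a ha b _ => by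
    rw [mem_augmentationSubmodule] at ha ⊢
    rw [map_mul, ha, zero_mul]
  obtain ⟨m, rfl⟩ := Nat.exists_eq_succ_of_ne_zero hm
  induction n, hmn using Nat.le_induction with
  | base => exact le_rfl
  | succ n hn ih =>
    refine le_trans ?_ ih
    obtain ⟨k, rfl⟩ := Nat.exists_eq_add_of_le' hn
    rw [show k + m.succ + 1 = k + m + 2 by omega, show k + m.succ = k + m + 1 by omega,
      pow_add, pow_succ _ (k + m), pow_two]
    exact mul_le_mul' le_rfl hmul

theorem mul_mem_augmentationSubmodule_pow (n : ℕ) {a : MonoidAlgebra K G}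
    (ha : a ∈ augmentationSubmodule K G ^ (n + 1)) (b : MonoidAlgebra K G) :
    a * b ∈ augmentationSubmodule K G ^ (n + 1) := by
  rw [show b = (b - augmentation K G b • 1) + augmentation K G b • 1 by abel, mul_add,
    mul_smul_comm, mul_one]
  refine add_mem (augmentationSubmodule_pow_le (Nat.le_succ _) (Nat.succ_ne_zero _) ?_)
    (Submodule.smul_mem _ _ ha)
  rw [pow_succ _ (n + 1)]
  exact Submodule.mul_mem_mul ha (sub_smul_one_mem_augmentationSubmodule b)

variable (K G) in
/-- The `(n + 1)`-th dimension subgroup of `G` over `K`. -/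
noncomputable def dimensionSubgroup (n : ℕ) : Subgroup G where
  carrier := {g | (single g 1 - 1 : MonoidAlgebra K G) ∈ augmentationSubmodule K G ^ (n + 1)}
  one_mem' := by simp [← one_def]
  mul_mem' {x y} hx hy := by
    have : (single (x * y) 1 - 1 : MonoidAlgebra K G) =
        (single x 1 - 1) * single y 1 + (single y 1 - 1) := by
      simp [sub_mul, single_mul_single]
    change (single (x * y) 1 - 1 : MonoidAlgebra K G) ∈ augmentationSubmodule K G ^ (n + 1)
    rw [this]
    exact add_mem (mul_mem_augmentationSubmodule_pow n hx _) hy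
  inv_mem' {x} hx := by
    have : (single x⁻¹ 1 - 1 : MonoidAlgebra K G) = -((single x 1 - 1) * single x⁻¹ 1) := by
      simp [sub_mul, single_mul_single, one_def]
    change (single x⁻¹ 1 - 1 : MonoidAlgebra K G) ∈ augmentationSubmodule K G ^ (n + 1)
    rw [this]
    exact neg_mem (mul_mem_augmentationSubmodule_pow n hx _)

open scoped commutatorElement in
theorem mul_sub_mul_mem_of_commutator_le {n : ℕ} (h : commutator G ≤ dimensionSubgroup K G n)
    (a b : MonoidAlgebra K G) : a * b - b * a ∈ augmentationSubmodule K G ^ (n + 1) := by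
  induction a using induction_single_one with
  | single_one x =>
    induction b using induction_single_one with
    | single_one y =>
      have hxy : (single ⁅x, y⁆ 1 - 1 : MonoidAlgebra K G) ∈
          augmentationSubmodule K G ^ (n + 1) :=
        h (Subgroup.commutator_mem_commutator (Subgroup.mem_top x) (Subgroup.mem_top y))
      convert mul_mem_augmentationSubmodule_pow n hxy (single (y * x) 1) using 1
      simp [sub_mul, single_mul_single, commutatorElement_def]
    | zero => simp
    | add a b ha hb => convert add_mem ha hb using 1; noncomm_ring
    | smul c a ha => convert! Submodule.smul_mem _ c ha using 1; simp [smul_sub]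
  | zero => simp
  | add a b ha hb => convert add_mem ha hb using 1; noncomm_ring
  | smul c a ha => convert! Submodule.smul_mem _ c ha using 1; simp [smul_sub]

theorem pow_prime_pow_mem_dimensionSubgroup {p : ℕ} [Fact p.Prime] [CharP K p] (g : G)
    {k n : ℕ} (hn : n + 1 ≤ p ^ k) : g ^ p ^ k ∈ dimensionSubgroup K G n := by
  have : CharP (MonoidAlgebra K G) p :=
    charP_of_injective_algebraMap (algebraMap K (MonoidAlgebra K G)).injective p
  have hpow : (single (g ^ p ^ k) 1 - 1 : MonoidAlgebra K G) = (single g 1 - 1) ^ p ^ k := by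
    rw [sub_pow_char_pow_of_commute p k (Commute.one_right _), one_pow, single_pow, one_pow]
  change (single (g ^ p ^ k) 1 - 1 : MonoidAlgebra K G) ∈ augmentationSubmodule K G ^ (n + 1)
  rw [hpow]
  exact augmentationSubmodule_pow_le hn (Nat.succ_ne_zero _)
    (Submodule.pow_mem_pow _ (single_sub_one_mem_augmentationSubmodule g) _)

/-- If two functionals vanish on the square of the augmentation ideal, their symmetrised product
on that ideal factors through multiplication modulo the cube. -/
theorem exists_functional_mul (φ ψ : MonoidAlgebra K G →ₗ[K] K)
    (hφ : ∀ a ∈ augmentationSubmodule K G ^ 2, φ a = 0)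
    (hψ : ∀ a ∈ augmentationSubmodule K G ^ 2, ψ a = 0) :
    ∃ F : MonoidAlgebra K G →ₗ[K] K,
      (∀ a ∈ augmentationSubmodule K G, ∀ b ∈ augmentationSubmodule K G,
        F (a * b) = φ a * ψ b + φ b * ψ a) ∧
      ∀ a ∈ augmentationSubmodule K G ^ 3, F a = 0 := by
  let ε := augmentation K G
  let D (f : MonoidAlgebra K G →ₗ[K] K) : MonoidAlgebra K G →ₗ[K] K :=
    f ∘ₗ (LinearMap.id - ε.toLinearMap.smulRight 1)
  have hD (f : MonoidAlgebra K G →ₗ[K] K) (a) : D f a = f (a - ε a • 1) := rfl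
  have hDJ (f : MonoidAlgebra K G →ₗ[K] K) {a} (ha : a ∈ augmentationSubmodule K G) :
      D f a = f a := by
    rw [hD, show ε a = 0 from ha, zero_smul, sub_zero]
  have hDmul (f : MonoidAlgebra K G →ₗ[K] K) (hf : ∀ a ∈ augmentationSubmodule K G ^ 2, f a = 0)
      (g h : G) : D f (single (g * h) 1) = D f (single g 1) + D f (single h 1) := by
    have hmem := Submodule.mul_mem_mul (single_sub_one_mem_augmentationSubmodule (K := K) g)
      (single_sub_one_mem_augmentationSubmodule h)
    rw [← pow_two] at hmem
    have := hf _ hmem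
    rw [hD, hD, hD, ← sub_eq_zero, ← map_add, ← map_sub, ← this]
    congr 1
    simp [ε, sub_mul, mul_sub, single_mul_single]
    abel
  let F := (MonoidAlgebra.basis G K).constr K
    fun g => D φ (single g 1) * D ψ (single g 1)
  have hF (g : G) : F (single g 1) = D φ (single g 1) * D ψ (single g 1) := by
    have := (MonoidAlgebra.basis G K).constr_basis K
      (fun g => D φ (single g 1) * D ψ (single g 1)) g
    rwa [MonoidAlgebra.basis_apply] at this
  have hFmul (a b : MonoidAlgebra K G) :
      F (a * b) = F a * ε b + ε a * F b + D φ a * D ψ b + D φ b * D ψ a := by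
    induction a using induction_single_one with
    | single_one x =>
      induction b using induction_single_one with
      | single_one y =>
        rw [single_mul_single, one_mul, hF, hF, hF, hDmul φ hφ, hDmul ψ hψ]
        simp only [ε, augmentation_single]
        ring
      | zero => simp
      | add a b ha hb => simp only [mul_add, map_add, ha, hb, add_mul]; ring
      | smul c a ha => simp only [mul_smul_comm, map_smul, ha, smul_eq_mul]; ring
    | zero => simp
    | add a b ha hb => simp only [mul_add, map_add, ha, hb, add_mul]; ring
    | smul c a ha => simp only [smul_mul_assoc, map_smul, ha, smul_eq_mul]; ring
  have hFJ : ∀ a ∈ augmentationSubmodule K G, ∀ b ∈ augmentationSubmodule K G,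
      F (a * b) = φ a * ψ b + φ b * ψ a := by
    intro a ha b hb
    rw [hFmul, show ε a = 0 from ha, show ε b = 0 from hb, hDJ _ ha, hDJ _ ha, hDJ _ hb, hDJ _ hb]
    ring
  refine ⟨F, hFJ, fun a ha => ?_⟩
  have hle : augmentationSubmodule K G ^ 3 ≤ LinearMap.ker F := by
    rw [pow_succ, Submodule.mul_le]
    intro a ha b hb
    have ha' := augmentationSubmodule_pow_le one_le_two one_ne_zero ha
    rw [pow_one] at ha'
    rw [LinearMap.mem_ker, hFJ a ha' b hb, hφ a ha, hψ a ha]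
    ring
  exact hle ha

end Augmentation

end MonoidAlgebra

section MultiplicativeBasis

variable {K A : Type*} [Field K] [Ring A] [Algebra K A]

/-- The coordinate functional at an element of a basis which lies outside a subspace spanned by
basis elements. -/
theorem exists_coord_functional {B : Set A} (hli : LinearIndependent K ((↑) : B → A))
    (hspan : Submodule.span K B = ⊤) {u : A} (hu : u ∈ B) :
    ∃ f : A →ₗ[K] K, f u = 1 ∧ (∀ v ∈ B, v ≠ u → f v = 0) ∧
      ∀ W : Submodule K A, Submodule.span K (B ∩ W) = W → u ∉ W → ∀ w ∈ W, f w = 0 := by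
  let b := Module.Basis.mk hli (by rw [Subtype.range_coe, hspan])
  have hb (v : B) : b v = v := Module.Basis.mk_apply hli _ v
  have hne : ∀ v ∈ B, v ≠ u → b.coord ⟨u, hu⟩ v = 0 := by
    intro v hv hvu
    have h : b.coord ⟨u, hu⟩ (b ⟨v, hv⟩) = 0 := by
      rw [Module.Basis.coord_apply, Module.Basis.repr_self, Finsupp.single_eq_of_ne]
      exact fun h => hvu (congrArg Subtype.val h).symm
    rwa [hb] at h
  refine ⟨b.coord ⟨u, hu⟩, ?_, hne, fun W hW huW w hw => ?_⟩
  · have h : b.coord ⟨u, hu⟩ (b ⟨u, hu⟩) = 1 := by simp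
    rwa [hb] at h
  · have hle : W ≤ LinearMap.ker (b.coord ⟨u, hu⟩) := by
      rw [← hW, Submodule.span_le]
      rintro v ⟨hv, hvW⟩
      exact hne v hv fun h => huW (h ▸ hvW)
    exact hle hw

theorem span_inter_pow_eq {B : Set A} (hmul : ∀ b₁ ∈ B, ∀ b₂ ∈ B, b₁ * b₂ = 0 ∨ b₁ * b₂ ∈ B)
    {J : Submodule K A} (hJ : Submodule.span K (B ∩ J) = J) (n : ℕ) :
    Submodule.span K (B ∩ (J ^ (n + 1) : Submodule K A)) = J ^ (n + 1) := by
  induction n with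
  | zero => simpa using hJ
  | succ n ih =>
    refine le_antisymm (Submodule.span_le.2 Set.inter_subset_right) ?_
    rw [pow_succ _ (n + 1)]
    conv_lhs => rw [← ih, ← hJ, Submodule.span_mul_span]
    rw [Submodule.span_le]
    rintro _ ⟨a, ⟨haB, haJ⟩, b, ⟨hbB, hbJ⟩, rfl⟩
    rw [hJ] at haJ
    have hab := Submodule.mul_mem_mul haJ hbJ
    rcases hmul a haB b hbB with h | h
    · simp [h]
    · exact Submodule.subset_span ⟨h, hab⟩

/-- A subalgebra containing a nilpotent subspace `J` modulo `J ^ 2` contains `J`. -/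
theorem Subalgebra.le_of_le_sup_sq {J : Submodule K A} (hnil : IsNilpotent J)
    (S : Subalgebra K A) (h : J ≤ (Subalgebra.toSubmodule S ⊓ J) ⊔ J ^ 2)
    (hJJ : J ^ 2 ≤ J) : J ≤ Subalgebra.toSubmodule S := by
  obtain ⟨N, hN⟩ := hnil
  set T := Subalgebra.toSubmodule S ⊓ J with hT
  have hTT : T * T ≤ T := Submodule.mul_le.2 fun a ha b hb =>
    ⟨S.mul_mem ha.1 hb.1, hJJ (pow_two J ▸ Submodule.mul_mem_mul ha.2 hb.2)⟩
  have hpow (n : ℕ) : J ^ (n + 1) ≤ J := by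
    induction n with
    | zero => simp
    | succ n ih =>
      rw [pow_succ]
      exact (mul_le_mul' ih le_rfl).trans (pow_two J ▸ hJJ)
  have key (n : ℕ) : J ≤ T ⊔ J ^ (n + 1) := by
    induction n with
    | zero => simp
    | succ n ih =>
      refine h.trans (sup_le le_sup_left ?_)
      rw [pow_two]
      refine (mul_le_mul' ih ih).trans ?_
      rw [Submodule.sup_mul, Submodule.mul_sup, Submodule.mul_sup]
      refine sup_le (sup_le (hTT.trans le_sup_left) (le_sup_of_le_right ?_))
        (sup_le (le_sup_of_le_right ?_) (le_sup_of_le_right ?_))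
      · rw [pow_succ' _ (n + 1)]
        exact mul_le_mul' inf_le_right le_rfl
      · rw [pow_succ _ (n + 1)]
        exact mul_le_mul' le_rfl inf_le_right
      · rw [pow_succ _ (n + 1)]
        exact mul_le_mul' le_rfl (hpow n)
  refine (key N).trans (sup_le inf_le_left ?_)
  rw [pow_succ, hN, zero_mul]
  exact bot_le

end MultiplicativeBasis

namespace MonoidAlgebra

variable {K : Type*} [Field K] {G : Type*} [Group G]

/-- Distinct elements of a multiplicative basis lying in the augmentation ideal but not in its
square commute, provided the algebra is commutative modulo the cube of that ideal. -/
theorem mul_comm_of_mem_multiplicativeBasis {B : Set (MonoidAlgebra K G)}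
    (hli : LinearIndependent K ((↑) : B → MonoidAlgebra K G)) (hspan : Submodule.span K B = ⊤)
    (hmul : ∀ b₁ ∈ B, ∀ b₂ ∈ B, b₁ * b₂ = 0 ∨ b₁ * b₂ ∈ B)
    (hJ : Submodule.span K (B ∩ augmentationSubmodule K G) = augmentationSubmodule K G)
    (hcomm : ∀ a b : MonoidAlgebra K G, a * b - b * a ∈ augmentationSubmodule K G ^ 3)
    {u v : MonoidAlgebra K G} (hu : u ∈ B) (hv : v ∈ B)
    (huJ : u ∈ augmentationSubmodule K G) (hvJ : v ∈ augmentationSubmodule K G)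
    (hu2 : u ∉ augmentationSubmodule K G ^ 2) (hv2 : v ∉ augmentationSubmodule K G ^ 2) :
    u * v = v * u := by
  rcases eq_or_ne u v with rfl | huv
  · rfl
  have hsq := span_inter_pow_eq hmul hJ 1
  have hcube := span_inter_pow_eq hmul hJ 2
  obtain ⟨φ, hφu, hφ, hφW⟩ := exists_coord_functional hli hspan hu
  obtain ⟨ψ, hψv, hψ, hψW⟩ := exists_coord_functional hli hspan hv
  obtain ⟨F, hF, hF3⟩ := exists_functional_mul φ ψ (hφW _ hsq hu2) (hψW _ hsq hv2)
  have huv3 : u * v ∉ augmentationSubmodule K G ^ 3 := fun h => by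
    have := hF3 _ h
    rw [hF u huJ v hvJ, hφu, hψv, hψ u hu huv] at this
    simp at this
  have hvu3 : v * u ∉ augmentationSubmodule K G ^ 3 := fun h =>
    huv3 (by simpa using add_mem (hcomm u v) h)
  have huvB : u * v ∈ B := (hmul u hu v hv).resolve_left fun h => huv3 (h ▸ zero_mem _)
  have hvuB : v * u ∈ B := (hmul v hv u hu).resolve_left fun h => hvu3 (h ▸ zero_mem _)
  by_contra hne
  obtain ⟨f, hf1, hf, hfW⟩ := exists_coord_functional hli hspan huvB
  have := hfW _ hcube huv3 _ (hcomm u v)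
  rw [map_sub, hf1, hf _ hvuB (Ne.symm hne)] at this
  simp at this

theorem mul_comm_of_multiplicativeBasis {B : Set (MonoidAlgebra K G)}
    (hli : LinearIndependent K ((↑) : B → MonoidAlgebra K G)) (hspan : Submodule.span K B = ⊤)
    (hmul : ∀ b₁ ∈ B, ∀ b₂ ∈ B, b₁ * b₂ = 0 ∨ b₁ * b₂ ∈ B)
    (hJ : Submodule.span K (B ∩ augmentationSubmodule K G) = augmentationSubmodule K G)
    (hnil : IsNilpotent (augmentationSubmodule K G))
    (hcomm : ∀ a b : MonoidAlgebra K G, a * b - b * a ∈ augmentationSubmodule K G ^ 3)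
    (a b : MonoidAlgebra K G) : a * b = b * a := by
  set J := augmentationSubmodule K G with hJdef
  set C : Set (MonoidAlgebra K G) := {u | u ∈ B ∧ u ∈ J ∧ u ∉ J ^ 2} with hC
  have hCcomm : ∀ x ∈ C, ∀ y ∈ C, x * y = y * x := fun x hx y hy =>
    mul_comm_of_mem_multiplicativeBasis hli hspan hmul hJ hcomm hx.1 hy.1 hx.2.1 hy.2.1
      hx.2.2 hy.2.2
  have hJJ : J ^ 2 ≤ J := by
    simpa using augmentationSubmodule_pow_le (K := K) (G := G) one_le_two one_ne_zero
  have hJS : J ≤ Subalgebra.toSubmodule (Algebra.adjoin K C) := by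
    refine Subalgebra.le_of_le_sup_sq hnil _ ?_ hJJ
    conv_lhs => rw [← hJ]
    rw [Submodule.span_le]
    rintro u ⟨huB, huJ⟩
    by_cases hu2 : u ∈ J ^ 2
    · exact Submodule.mem_sup_right hu2
    · exact Submodule.mem_sup_left ⟨Algebra.subset_adjoin ⟨huB, huJ, hu2⟩, huJ⟩
  have htop (x : MonoidAlgebra K G) : x ∈ Algebra.adjoin K C := by
    rw [← sub_add_cancel x (augmentation K G x • 1)]
    exact add_mem (hJS (sub_smul_one_mem_augmentationSubmodule x))
      (Subalgebra.smul_mem _ (one_mem _) _)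
  have := Algebra.isMulCommutative_adjoin K hCcomm
  exact setLike_mul_comm (htop a) (htop b)

end MonoidAlgebra

/-- If `G` is a finite nonabelian powerful `p`-group and `K` is a field of
characteristic `p`, then the group algebra `KG` has no filtered multiplicative
`K`-basis. -/
theorem no_filtered_mult_basis_of_powerful (p : ℕ) [Fact p.Prime]
    (K : Type*) [Field K] [CharP K p]
    (G : Type*) [Group G] [Fintype G] (hG : IsPGroup p G)
    (hnab : ∃ x y : G, x * y ≠ y * x)
    (hpowerful : commutator G ≤
      Subgroup.closure {x : G | ∃ g : G, x = g ^ (if p = 2 then 4 else p)}) :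
    ¬ ∃ B : Set (MonoidAlgebra K G), IsFilteredMultiplicativeBasis K B := by
  rintro ⟨B, hli, hspan, hmul, -, hrad⟩
  have hJ := MonoidAlgebra.restrictScalars_jacobson_bot (K := K) hG
  rw [hJ, ← Submodule.coe_restrictScalars K, hJ] at hrad
  have hdim : commutator G ≤ MonoidAlgebra.dimensionSubgroup K G 2 := by
    refine hpowerful.trans ((Subgroup.closure_le _).2 ?_)
    rintro _ ⟨g, rfl⟩
    split_ifs with hp
    · subst hp
      exact MonoidAlgebra.pow_prime_pow_mem_dimensionSubgroup (p := 2) (k := 2) g (by norm_num)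
    · have h3 : 3 ≤ p := lt_of_le_of_ne (Fact.out (p := p.Prime)).two_le (Ne.symm hp)
      simpa using MonoidAlgebra.pow_prime_pow_mem_dimensionSubgroup (K := K) (p := p) (k := 1)
        (n := 2) g (by simpa using h3)
  obtain ⟨x, y, hxy⟩ := hnab
  have h := MonoidAlgebra.mul_comm_of_multiplicativeBasis hli hspan hmul hrad
    (MonoidAlgebra.isNilpotent_augmentationSubmodule hG)
    (MonoidAlgebra.mul_sub_mul_mem_of_commutator_le hdim)
    (MonoidAlgebra.single x 1) (MonoidAlgebra.single y 1)
  rw [MonoidAlgebra.single_mul_single, MonoidAlgebra.single_mul_single] at h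
  exact hxy (MonoidAlgebra.of_injective (R := K) (by simpa [MonoidAlgebra.of_apply] using h))
end

section
/- Let p be an odd prime, let K be a field of characteristic p, and let G be a finite nonabelian p-group generated by two elements whose commutator subgroup is cyclic and contained in the center of G. Then the group algebra KG does not have a filtered multiplicative K-basis. -/
section FilteredAlgebra

variable {K A : Type*} [Field K] [Ring A] [Algebra K A] {J : Submodule K A}

theorem Submodule.mul_mem_pow_of_add_eq {i j k : ℕ} {a b : A} (ha : a ∈ J ^ i) (hb : b ∈ J ^ j)
    (h : i + j = k) : a * b ∈ J ^ k := by
  rw [← h, pow_add]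
  exact Submodule.mul_mem_mul ha hb

theorem Submodule.pow_le_pow_of_mul_le (hJ : J * J ≤ J) {m n : ℕ} (hm : 1 ≤ m) (hmn : m ≤ n) :
    J ^ n ≤ J ^ m := by
  induction n, hmn using Nat.le_induction with
  | base => exact le_rfl
  | succ n hn ih =>
    refine le_trans ?_ ih
    obtain ⟨k, rfl⟩ : ∃ k, n = k + 1 := ⟨n - 1, by omega⟩
    rw [pow_succ, pow_succ, mul_assoc]
    exact mul_le_mul' le_rfl hJ

theorem Submodule.mul_mem_pow_left (hl : ⊤ * J ≤ J) {n : ℕ} (hn : 1 ≤ n) {b : A}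
    (hb : b ∈ J ^ n) (a : A) : a * b ∈ J ^ n := by
  obtain ⟨k, rfl⟩ : ∃ k, n = k + 1 := ⟨n - 1, by omega⟩
  have h : ⊤ * J ^ (k + 1) ≤ J ^ (k + 1) := by
    rw [pow_succ', ← mul_assoc]
    exact mul_le_mul' hl le_rfl
  exact h (Submodule.mul_mem_mul trivial hb)

theorem Submodule.mul_mem_pow_right (hr : J * ⊤ ≤ J) {n : ℕ} (hn : 1 ≤ n) {b : A}
    (hb : b ∈ J ^ n) (a : A) : b * a ∈ J ^ n := by
  obtain ⟨k, rfl⟩ : ∃ k, n = k + 1 := ⟨n - 1, by omega⟩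
  have h : J ^ (k + 1) * ⊤ ≤ J ^ (k + 1) := by
    rw [pow_succ, mul_assoc]
    exact mul_le_mul' le_rfl hr
  exact h (Submodule.mul_mem_mul hb trivial)

theorem Submodule.pow_add_le_mul_sup (hJ : J * J ≤ J) {X Y : Submodule K A} {m n : ℕ} (hn : 1 ≤ n)
    (hX : J ^ m ≤ X ⊔ J ^ (m + 1)) (hY : J ^ n ≤ Y ⊔ J ^ (n + 1)) :
    J ^ (m + n) ≤ X * Y ⊔ J ^ (m + n + 1) := by
  rw [pow_add, Submodule.mul_le]
  intro u hu v hv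
  obtain ⟨q, hq, r, hr, rfl⟩ := Submodule.mem_sup.1 (hX hu)
  obtain ⟨q', hq', r', hr', rfl⟩ := Submodule.mem_sup.1 (hY hv)
  have e : (q + r) * (q' + r') = q * q' + ((q + r) * r' + r * q') := by noncomm_ring
  rw [e]
  have hqJ : q' ∈ J ^ n :=
    (Submodule.add_mem_iff_left _ (Submodule.pow_le_pow_of_mul_le hJ hn n.le_succ hr')).1 hv
  refine Submodule.add_mem_sup (Submodule.mul_mem_mul hq hq') (add_mem ?_ ?_)
  · exact Submodule.mul_mem_pow_of_add_eq hu hr' rfl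
  · exact Submodule.mul_mem_pow_of_add_eq hr hqJ (by omega)

theorem Submodule.eq_top_of_forall_pow_le (h1 : (⊤ : Submodule K A) ≤ 1 ⊔ J)
    {N : ℕ} (hN : J ^ N = ⊥) (Q : Submodule K A) (h : ∀ n, J ^ n ≤ Q ⊔ J ^ (n + 1)) : Q = ⊤ := by
  have key : ∀ k n, J ^ n ≤ Q ⊔ J ^ (n + k) := by
    intro k
    induction k with
    | zero => intro n; exact le_sup_right
    | succ k ih =>
      intro n
      exact (ih n).trans (sup_le le_sup_left (h (n + k)))
  have key2 : ∀ n, J ^ n ≤ Q := by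
    intro n
    refine (key N n).trans (sup_le le_rfl ?_)
    rw [pow_add, hN, Submodule.mul_bot]
    exact bot_le
  rw [eq_top_iff]
  refine h1.trans (sup_le ?_ ?_)
  · simpa using key2 0
  · simpa using key2 1

theorem Submodule.commute_of_generators (h1 : (⊤ : Submodule K A) ≤ 1 ⊔ J) (hJJ : J * J ≤ J)
    {N : ℕ} (hN : J ^ N = ⊥) {a b : A} (hJ : J ≤ Submodule.span K {a, b} ⊔ J ^ 2)
    (hab : a * b = b * a) (x y : A) : x * y = y * x := by
  have hP : Submodule.span K {a, b} ≤ Subalgebra.toSubmodule (Algebra.adjoin K {a, b}) :=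
    Algebra.span_le_adjoin K _
  have hQ : Subalgebra.toSubmodule (Algebra.adjoin K {a, b}) = ⊤ := by
    refine Submodule.eq_top_of_forall_pow_le h1 hN _ fun n => ?_
    induction n with
    | zero =>
      rw [pow_zero]
      exact le_sup_of_le_left (Submodule.one_le.2 (one_mem (Algebra.adjoin K {a, b})))
    | succ n ih =>
      have hJ' : J ^ 1 ≤ Subalgebra.toSubmodule (Algebra.adjoin K {a, b}) ⊔ J ^ (1 + 1) := by
        rw [pow_one]
        exact hJ.trans (sup_le_sup_right hP _)
      refine (Submodule.pow_add_le_mul_sup hJJ le_rfl ih hJ').trans (sup_le_sup_right ?_ _)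
      rw [Submodule.mul_le]
      exact fun u hu v hv => Subalgebra.mul_mem _ hu hv
  have hmem : ∀ z : A, z ∈ Algebra.adjoin K {a, b} := fun z => by
    rw [← Subalgebra.mem_toSubmodule, hQ]; trivial
  have hc : ∀ s ∈ ({a, b} : Set A), Commute x s := by
    intro s hs
    refine (Algebra.commute_of_mem_adjoin_of_forall_mem_commute (hmem x) ?_).symm
    rintro t (rfl | rfl) <;> rcases hs with rfl | rfl
    all_goals first | exact Commute.refl _ | exact hab | exact hab.symm
  exact Algebra.commute_of_mem_adjoin_of_forall_mem_commute (hmem y) hc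

/-- If the two mixed products of a pair of generators are of order at least three, then the powers
of the generators span the algebra. -/
theorem Submodule.span_pow_eq_top (h1 : (⊤ : Submodule K A) ≤ 1 ⊔ J) (hJJ : J * J ≤ J)
    {N : ℕ} (hN : J ^ N = ⊥) {a b : A} (ha : a ∈ J) (hb : b ∈ J)
    (hJ : J ≤ Submodule.span K {a, b} ⊔ J ^ 2)
    (hab : a * b ∈ J ^ 3) (hba : b * a ∈ J ^ 3) :
    Submodule.span K (Set.range (fun n : ℕ => a ^ n) ∪ Set.range (fun n : ℕ => b ^ n)) = ⊤ := by
  have hJ' : J ^ 1 ≤ Submodule.span K {a, b} ⊔ J ^ (1 + 1) := by rwa [pow_one]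
  have key : ∀ n, J ^ (n + 1) ≤ Submodule.span K {a ^ (n + 1), b ^ (n + 1)} ⊔ J ^ (n + 1 + 1) := by
    intro n
    induction n with
    | zero => simpa using hJ
    | succ n ih =>
      refine (Submodule.pow_add_le_mul_sup hJJ le_rfl ih hJ').trans (sup_le ?_ le_sup_right)
      rw [Submodule.span_mul_span, Submodule.span_le]
      have hm : ∀ {c d : A}, c ∈ J → c * d ∈ J ^ 3 → c ^ (n + 1) * d ∈ J ^ (n + 1 + 1 + 1) := by
        intro c d hc hd
        have := Submodule.mul_mem_pow_of_add_eq (Submodule.pow_mem_pow J hc n) hd rfl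
        rwa [← mul_assoc, ← pow_succ] at this
      rintro _ ⟨s, (rfl | rfl), t, (rfl | rfl), rfl⟩
      · exact Submodule.mem_sup_left (Submodule.subset_span (by simp [← pow_succ]))
      · exact Submodule.mem_sup_right (hm ha hab)
      · exact Submodule.mem_sup_right (hm hb hba)
      · exact Submodule.mem_sup_left (Submodule.subset_span (by simp [← pow_succ]))
  refine Submodule.eq_top_of_forall_pow_le h1 hN _ fun n => ?_
  cases n with
  | zero =>
    rw [pow_zero]
    exact le_sup_of_le_left (Submodule.one_le.2 (Submodule.subset_span (Or.inl ⟨0, pow_zero a⟩)))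
  | succ n =>
    refine (key n).trans (sup_le_sup_right (Submodule.span_mono ?_) _)
    rintro _ (rfl | rfl)
    exacts [Or.inl ⟨_, rfl⟩, Or.inr ⟨_, rfl⟩]

/-- If commutators of elements of `J` annihilate `J` modulo `J ^ 4`, then the ordered
monomials in a pair of generators `u`, `v`, together with `v * u`, span the algebra. -/
theorem Submodule.span_ordered_monomials_eq_top (h1 : (⊤ : Submodule K A) ≤ 1 ⊔ J)
    (hJJ : J * J ≤ J) {N : ℕ} (hN : J ^ N = ⊥) {u v : A} (hu : u ∈ J) (hv : v ∈ J)
    (hJ : J ≤ Submodule.span K {u, v} ⊔ J ^ 2)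
    (hl : ∀ a ∈ J, (v * u - u * v) * a ∈ J ^ 4) (hr : ∀ a ∈ J, a * (v * u - u * v) ∈ J ^ 4) :
    Submodule.span K (insert (v * u) (Set.range fun n : ℕ × ℕ => u ^ n.1 * v ^ n.2)) = ⊤ := by
  have hpow : ∀ i, 2 ≤ i → v * u ^ i - u ^ i * v ∈ J ^ (i + 2) := by
    intro i hi
    induction i, hi using Nat.le_induction with
    | base =>
      have e : v * u ^ 2 - u ^ 2 * v = (v * u - u * v) * u + u * (v * u - u * v) := by noncomm_ring
      rw [e]
      exact add_mem (hl u hu) (hr u hu)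
    | succ i hi ih =>
      obtain ⟨k, rfl⟩ : ∃ k, i = k + 1 := ⟨i - 1, by omega⟩
      have e : v * u ^ (k + 1 + 1) - u ^ (k + 1 + 1) * v =
          (v * u ^ (k + 1) - u ^ (k + 1) * v) * u + u ^ k * (u * (v * u - u * v)) := by
        simp only [pow_succ]; noncomm_ring
      rw [e]
      refine add_mem ?_ ?_
      · exact Submodule.mul_mem_pow_of_add_eq ih (show u ∈ J ^ 1 by rwa [pow_one]) (by omega)
      · exact Submodule.mul_mem_pow_of_add_eq (Submodule.pow_mem_pow J hu k) (hr u hu) (by omega)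
  have hmon : ∀ i j, 2 ≤ i + j → v * (u ^ i * v ^ j) - u ^ i * v ^ (j + 1) ∈ J ^ (i + j + 2) := by
    intro i j hij
    have e : v * (u ^ i * v ^ j) - u ^ i * v ^ (j + 1) = (v * u ^ i - u ^ i * v) * v ^ j := by
      rw [pow_succ']; noncomm_ring
    rw [e]
    rcases (by omega : i = 0 ∨ i = 1 ∨ 2 ≤ i) with rfl | rfl | hi
    · simp
    · obtain ⟨k, rfl⟩ : ∃ k, j = k + 1 := ⟨j - 1, by omega⟩
      rw [pow_succ' v, ← mul_assoc, pow_one]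
      exact Submodule.mul_mem_pow_of_add_eq (hl v hv) (Submodule.pow_mem_pow J hv k) (by omega)
    · exact Submodule.mul_mem_pow_of_add_eq (hpow i hi) (Submodule.pow_mem_pow J hv j) (by omega)
  set R : ℕ → Submodule K A := fun n =>
    Submodule.span K {x | ∃ i j, i + j = n ∧ x = u ^ i * v ^ j} with hR
  have hJ' : J ^ 1 ≤ Submodule.span K {u, v} ⊔ J ^ (1 + 1) := by rwa [pow_one]
  have hPR : ∀ n, 2 ≤ n → Submodule.span K {u, v} * R n ≤ R (n + 1) ⊔ J ^ (n + 1 + 1) := by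
    intro n hn
    rw [hR, Submodule.span_mul_span, Submodule.span_le]
    rintro _ ⟨s, (rfl | rfl), _, ⟨i, j, hij, rfl⟩, rfl⟩
    · refine Submodule.mem_sup_left (Submodule.subset_span ⟨i + 1, j, by omega, ?_⟩)
      simp [pow_succ', mul_assoc]
    · have := hmon i j (hij ▸ hn)
      rw [hij] at this
      simp only [SetLike.mem_coe]
      rw [← add_sub_cancel (u ^ i * s ^ (j + 1)) (s * (u ^ i * s ^ j))]
      exact Submodule.add_mem_sup (Submodule.subset_span ⟨i, j + 1, by omega, rfl⟩) this
  have h2 : J ^ 2 ≤ (R 2 ⊔ Submodule.span K {v * u}) ⊔ J ^ (2 + 1) := by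
    refine (Submodule.pow_add_le_mul_sup hJJ le_rfl hJ' hJ').trans (sup_le_sup_right ?_ _)
    rw [Submodule.span_mul_span, Submodule.span_le]
    rintro _ ⟨s, (rfl | rfl), t, (rfl | rfl), rfl⟩
    · exact Submodule.mem_sup_left (Submodule.subset_span ⟨2, 0, rfl, by simp [pow_two]⟩)
    · exact Submodule.mem_sup_left (Submodule.subset_span ⟨1, 1, rfl, by simp⟩)
    · exact Submodule.mem_sup_right (Submodule.mem_span_singleton_self _)
    · exact Submodule.mem_sup_left (Submodule.subset_span ⟨0, 2, rfl, by simp [pow_two]⟩)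
  have h3 : ∀ n, J ^ (n + 3) ≤ R (n + 3) ⊔ J ^ (n + 3 + 1) := by
    intro n
    induction n with
    | zero =>
      refine (Submodule.pow_add_le_mul_sup hJJ (by norm_num) hJ' h2).trans (sup_le ?_ le_sup_right)
      rw [Submodule.mul_sup]
      refine sup_le (hPR 2 le_rfl) ?_
      rw [Submodule.span_mul_span, Submodule.span_le]
      rintro _ ⟨s, hs, _, rfl, rfl⟩
      have hsJ : s ∈ J := by rcases hs with rfl | rfl <;> assumption
      have hRs : s * (u * v) ∈ R (0 + 3) ⊔ J ^ (0 + 3 + 1) := by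
        refine hPR 2 le_rfl (Submodule.mul_mem_mul (Submodule.subset_span hs)
          (Submodule.subset_span ⟨1, 1, rfl, by simp⟩))
      have e : s * (v * u) = s * (u * v) + s * (v * u - u * v) := by noncomm_ring
      simp only [SetLike.mem_coe]
      rw [e]
      exact add_mem hRs (Submodule.mem_sup_right (hr s hsJ))
    | succ n ih =>
      have := Submodule.pow_add_le_mul_sup hJJ (by omega) hJ' ih
      rw [show 1 + (n + 3) = n + 1 + 3 by omega] at this
      exact this.trans (sup_le (hPR (n + 3) (by omega)) le_sup_right)
  have hRle : ∀ n, R n ≤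
      Submodule.span K (insert (v * u) (Set.range fun n : ℕ × ℕ => u ^ n.1 * v ^ n.2)) := by
    intro n
    refine Submodule.span_mono ?_
    rintro _ ⟨i, j, -, rfl⟩
    exact Or.inr ⟨(i, j), rfl⟩
  refine Submodule.eq_top_of_forall_pow_le h1 hN _ fun n => ?_
  rcases n with _ | _ | _ | n
  · rw [pow_zero]
    exact le_sup_of_le_left (Submodule.one_le.2 (Submodule.subset_span (Or.inr ⟨(0, 0), by simp⟩)))
  · refine hJ'.trans (sup_le_sup_right (Submodule.span_le.2 ?_) _)
    rintro _ (rfl | rfl)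
    exacts [Submodule.subset_span (Or.inr ⟨(1, 0), by simp⟩),
      Submodule.subset_span (Or.inr ⟨(0, 1), by simp⟩)]
  · refine h2.trans (sup_le_sup_right (sup_le (hRle 2) (Submodule.span_mono ?_)) _)
    simp
  · exact (h3 n).trans (sup_le_sup_right (hRle _) _)

end FilteredAlgebra

section MultiplicativeBasis

variable {K A : Type*} [Field K] [Ring A] [Algebra K A] {J : Submodule K A} {B : Set A}

theorem pow_le_span_inter (hmul : ∀ b₁ ∈ B, ∀ b₂ ∈ B, b₁ * b₂ = 0 ∨ b₁ * b₂ ∈ B)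
    (hJ : Submodule.span K (B ∩ J) = J) {n : ℕ} (hn : 1 ≤ n) :
    J ^ n ≤ Submodule.span K (B ∩ (J ^ n : Submodule K A)) := by
  induction n, hn using Nat.le_induction with
  | base => rw [pow_one, hJ]
  | succ n hn ih =>
    calc J ^ (n + 1) = J ^ n * J := pow_succ _ _
      _ ≤ Submodule.span K (B ∩ (J ^ n : Submodule K A)) * Submodule.span K (B ∩ J) :=
        mul_le_mul' ih hJ.ge
      _ ≤ _ := by
        rw [Submodule.span_mul_span, Submodule.span_le]
        rintro _ ⟨a, ⟨haB, ha⟩, b, ⟨hbB, hb⟩, rfl⟩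
        rcases hmul a haB b hbB with h | h
        · simp [h]
        · refine Submodule.subset_span ⟨h, ?_⟩
          rw [pow_succ]
          exact Submodule.mul_mem_mul ha hb

theorem exists_coordinate (hli : LinearIndependent K ((↑) : B → A))
    (hspan : Submodule.span K B = ⊤) {P : Submodule K A} (hP : P ≤ Submodule.span K (B ∩ P))
    {m : A} (hm : m ∈ insert 0 B) (hmP : m ∉ P) :
    ∃ φ : A →ₗ[K] K, (∀ a ∈ P, φ a = 0) ∧ φ m = 1 ∧ ∀ m' ∈ insert 0 B, m' ≠ m → φ m' = 0 := by
  classical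
  have hmB : m ∈ B := by
    rcases hm with rfl | h
    exacts [absurd (zero_mem P) hmP, h]
  let e : Module.Basis B K A := Module.Basis.mk hli (by simp [hspan])
  have he : ∀ b : B, e b = b := fun b => by simp [e]
  refine ⟨e.coord ⟨m, hmB⟩, ?_, ?_, ?_⟩
  · intro a ha
    have hle : P ≤ LinearMap.ker (e.coord ⟨m, hmB⟩) := by
      refine hP.trans (Submodule.span_le.2 ?_)
      rintro b ⟨hb, hbP⟩
      have hne : (⟨b, hb⟩ : B) ≠ ⟨m, hmB⟩ := fun h => hmP (Subtype.mk.inj h ▸ hbP)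
      have := e.repr_self_apply ⟨b, hb⟩ ⟨m, hmB⟩
      rw [he, if_neg hne] at this
      simpa using this
    exact hle ha
  · have := e.repr_self_apply ⟨m, hmB⟩ ⟨m, hmB⟩
    rw [he, if_pos rfl] at this
    simpa using this
  · rintro b (rfl | hb) hbm
    · simp
    · have hne : (⟨b, hb⟩ : B) ≠ ⟨m, hmB⟩ := fun h => hbm (Subtype.mk.inj h)
      have := e.repr_self_apply ⟨b, hb⟩ ⟨m, hmB⟩
      rw [he, if_neg hne] at this
      simpa using this

theorem eq_or_mem_of_sub_mem (hli : LinearIndependent K ((↑) : B → A))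
    (hspan : Submodule.span K B = ⊤) {P : Submodule K A} (hP : P ≤ Submodule.span K (B ∩ P))
    {x y : A} (hx : x ∈ insert 0 B) (hy : y ∈ insert 0 B) (h : x - y ∈ P) :
    x = y ∨ x ∈ P ∧ y ∈ P := by
  by_cases hxP : x ∈ P
  · exact Or.inr ⟨hxP, (Submodule.sub_mem_iff_right _ hxP).1 h⟩
  · obtain ⟨φ, h0, h1, h2⟩ := exists_coordinate hli hspan hP hx hxP
    by_contra! hne
    have := h0 _ h
    rw [map_sub, h1, h2 y hy (Ne.symm hne.1)] at this
    simp at this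

theorem sub_mem_of_second_difference_mem (h2 : (2 : K) ≠ 0)
    (hli : LinearIndependent K ((↑) : B → A))
    (hspan : Submodule.span K B = ⊤) {P : Submodule K A} (hP : P ≤ Submodule.span K (B ∩ P))
    {x y z : A} (hx : x ∈ insert 0 B) (hy : y ∈ insert 0 B) (hz : z ∈ insert 0 B)
    (h : x - y - (y - z) ∈ P) : x - y ∈ P := by
  by_cases hxP : x ∈ P
  · by_cases hyP : y ∈ P
    · exact sub_mem hxP hyP
    · obtain ⟨φ, e0, e1, e2⟩ := exists_coordinate hli hspan hP hy hyP
      have hxy : x ≠ y := fun e => hyP (e ▸ hxP)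
      have := e0 _ h
      by_cases hzy : z = y
      · subst hzy
        simp [e1, e0 x hxP] at this
      · simp only [map_sub, e1, e0 x hxP, e2 z hz hzy] at this
        refine absurd ?_ h2
        linear_combination -this
  · obtain ⟨φ, e0, e1, e2⟩ := exists_coordinate hli hspan hP hx hxP
    by_cases hyx : y = x
    · simp [hyx]
    · have := e0 _ h
      exfalso
      by_cases hzx : z = x
      · subst hzx
        simp only [map_sub, e1, e2 y hy hyx] at this
        exact h2 (by linear_combination this)
      · simp [map_sub, e1, e2 y hy hyx, e2 z hz hzx] at this

end MultiplicativeBasis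

section Commutators

variable {K A : Type*} [Field K] [Ring A] [Algebra K A] {J : Submodule K A}

theorem commutator_mem_of_generators (hJJ : J * J ≤ J) {a b : A} (ha : a ∈ J) (hb : b ∈ J)
    (hJ : J ≤ Submodule.span K {a, b} ⊔ J ^ 2) {x y : A} (hx : x ∈ J) (hy : y ∈ J) :
    ∃ c : K, x * y - y * x - c • (a * b - b * a) ∈ J ^ 3 := by
  have hJ1 : ∀ {z}, z ∈ J → z ∈ J ^ 1 := fun h => by rwa [pow_one]
  have h21 : ∀ {z}, z ∈ J ^ 2 → z ∈ J := fun h => by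
    simpa using Submodule.pow_le_pow_of_mul_le hJJ le_rfl one_le_two h
  obtain ⟨q, hq, r, hr, rfl⟩ := Submodule.mem_sup.1 (hJ hx)
  obtain ⟨s, hs, t, ht, rfl⟩ := Submodule.mem_sup.1 (hJ hy)
  obtain ⟨α, β, rfl⟩ := Submodule.mem_span_pair.1 hq
  obtain ⟨γ, δ, rfl⟩ := Submodule.mem_span_pair.1 hs
  refine ⟨α * δ - β * γ, ?_⟩
  set q := α • a + β • b with hq'
  set s := γ • a + δ • b with hs'
  have hqJ : q ∈ J := add_mem (J.smul_mem _ ha) (J.smul_mem _ hb)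
  have e : (q + r) * (s + t) - (s + t) * (q + r) - (α * δ - β * γ) • (a * b - b * a) =
      (q * t - t * q) + (r * (s + t) - (s + t) * r) + (q * s - s * q -
        (α * δ - β * γ) • (a * b - b * a)) := by
    noncomm_ring
  have e2 : q * s - s * q - (α * δ - β * γ) • (a * b - b * a) = 0 := by
    rw [hq', hs']
    simp only [mul_add, add_mul, smul_mul_smul_comm, smul_sub, sub_smul, mul_comm γ, mul_comm δ]
    abel
  rw [e, e2, add_zero]
  refine add_mem (sub_mem ?_ ?_) (sub_mem ?_ ?_)
  · exact Submodule.mul_mem_pow_of_add_eq (hJ1 hqJ) ht rfl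
  · exact Submodule.mul_mem_pow_of_add_eq ht (hJ1 hqJ) rfl
  · exact Submodule.mul_mem_pow_of_add_eq hr (hJ1 hy) rfl
  · exact Submodule.mul_mem_pow_of_add_eq (hJ1 hy) hr rfl

theorem commutator_mul_mem_of_generators (hJJ : J * J ≤ J) {a b : A} (ha : a ∈ J) (hb : b ∈ J)
    (hJ : J ≤ Submodule.span K {a, b} ⊔ J ^ 2)
    (h1 : (a * b - b * a) * a ∈ J ^ 4) (h2 : (a * b - b * a) * b ∈ J ^ 4) {x y z : A}
    (hx : x ∈ J) (hy : y ∈ J) (hz : z ∈ J) : (x * y - y * x) * z ∈ J ^ 4 := by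
  have hJ1 : ∀ {z}, z ∈ J → z ∈ J ^ 1 := fun h => by rwa [pow_one]
  have hab : a * b - b * a ∈ J ^ 2 := by
    rw [pow_two]
    exact sub_mem (Submodule.mul_mem_mul ha hb) (Submodule.mul_mem_mul hb ha)
  have hc : (a * b - b * a) * z ∈ J ^ 4 := by
    obtain ⟨q, hq, r, hr, rfl⟩ := Submodule.mem_sup.1 (hJ hz)
    obtain ⟨α, β, rfl⟩ := Submodule.mem_span_pair.1 hq
    rw [mul_add, mul_add, mul_smul_comm, mul_smul_comm]
    exact add_mem (add_mem (Submodule.smul_mem _ _ h1) (Submodule.smul_mem _ _ h2))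
      (Submodule.mul_mem_pow_of_add_eq hab hr rfl)
  obtain ⟨c, hxy⟩ := commutator_mem_of_generators hJJ ha hb hJ hx hy
  have := add_mem (Submodule.mul_mem_pow_of_add_eq hxy (hJ1 hz) rfl) (Submodule.smul_mem _ c hc)
  rwa [← smul_mul_assoc, ← add_mul, sub_add_cancel] at this

end Commutators

section Augmentation

open MonoidAlgebra

/-- The augmentation ideal of a group algebra, as the span of the elements `g - 1`. -/
noncomputable def augmentationSpan (K G : Type*) [Field K] [Group G] :
    Submodule K (MonoidAlgebra K G) :=
  Submodule.span K (Set.range fun g : G => of K G g - 1)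

variable {K G : Type*} [Field K] [Group G]

theorem of_sub_one_mem (g : G) : of K G g - 1 ∈ augmentationSpan K G :=
  Submodule.subset_span ⟨g, rfl⟩

theorem span_range_of : Submodule.span K (Set.range (of K G)) = ⊤ := by
  rw [eq_top_iff]
  rintro x -
  induction x using MonoidAlgebra.induction_on with
  | of g => exact Submodule.subset_span ⟨g, rfl⟩
  | add x y hx hy => exact add_mem hx hy
  | smul r x hx => exact Submodule.smul_mem _ r hx

theorem top_le_one_sup_augmentationSpan :
    (⊤ : Submodule K (MonoidAlgebra K G)) ≤ 1 ⊔ augmentationSpan K G := by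
  rw [← span_range_of, Submodule.span_le]
  rintro _ ⟨g, rfl⟩
  rw [SetLike.mem_coe, ← add_sub_cancel 1 (of K G g)]
  exact Submodule.add_mem_sup (Submodule.one_le.1 le_rfl) (of_sub_one_mem g)

theorem top_mul_augmentationSpan :
    (⊤ : Submodule K (MonoidAlgebra K G)) * augmentationSpan K G ≤ augmentationSpan K G := by
  rw [← span_range_of, augmentationSpan, Submodule.span_mul_span, Submodule.span_le]
  rintro _ ⟨_, ⟨h, rfl⟩, _, ⟨g, rfl⟩, rfl⟩
  have e : of K G h * (of K G g - 1) = (of K G (h * g) - 1) - (of K G h - 1) := by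
    rw [map_mul]; noncomm_ring
  simp only [SetLike.mem_coe]
  rw [e]
  exact sub_mem (of_sub_one_mem _) (of_sub_one_mem _)

theorem augmentationSpan_mul_top :
    augmentationSpan K G * (⊤ : Submodule K (MonoidAlgebra K G)) ≤ augmentationSpan K G := by
  rw [← span_range_of, augmentationSpan, Submodule.span_mul_span, Submodule.span_le]
  rintro _ ⟨_, ⟨g, rfl⟩, _, ⟨h, rfl⟩, rfl⟩
  have e : (of K G g - 1) * of K G h = (of K G (g * h) - 1) - (of K G h - 1) := by
    rw [map_mul]; noncomm_ring
  simp only [SetLike.mem_coe]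
  rw [e]
  exact sub_mem (of_sub_one_mem _) (of_sub_one_mem _)

theorem augmentationSpan_mul_self :
    augmentationSpan K G * augmentationSpan K G ≤ augmentationSpan K G :=
  (mul_le_mul' le_top le_rfl).trans top_mul_augmentationSpan

theorem augmentationSpan_le_of_closure {x y : G}
    (hxy : Subgroup.closure {x, y} = (⊤ : Subgroup G)) :
    augmentationSpan K G ≤
      Submodule.span K {of K G x - 1, of K G y - 1} ⊔ augmentationSpan K G ^ 2 := by
  have hmul : ∀ g h : G, (of K G g - 1) * (of K G h - 1) ∈ augmentationSpan K G ^ 2 := fun g h => by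
    rw [pow_two]
    exact Submodule.mul_mem_mul (of_sub_one_mem g) (of_sub_one_mem h)
  rw [augmentationSpan, Submodule.span_le, ← augmentationSpan]
  rintro _ ⟨g, rfl⟩
  have hg : g ∈ Subgroup.closure {x, y} := hxy ▸ Subgroup.mem_top g
  simp only [SetLike.mem_coe]
  induction hg using Subgroup.closure_induction with
  | mem g hg =>
    refine Submodule.mem_sup_left (Submodule.subset_span ?_)
    rcases hg with rfl | rfl <;> simp
  | one => rw [map_one, sub_self]; exact zero_mem _
  | mul g h _ _ ihg ihh =>
    have e : of K G (g * h) - 1 = (of K G g - 1) + (of K G h - 1) +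
        (of K G g - 1) * (of K G h - 1) := by
      rw [map_mul]; noncomm_ring
    rw [e]
    exact add_mem (add_mem ihg ihh) (Submodule.mem_sup_right (hmul _ _))
  | inv g _ ih =>
    have h1 : of K G g * of K G g⁻¹ = 1 := by rw [← map_mul, mul_inv_cancel, map_one]
    have e : of K G g⁻¹ - 1 = -(of K G g - 1) - (of K G g - 1) * (of K G g⁻¹ - 1) := by
      rw [sub_mul, mul_sub, h1]; noncomm_ring
    rw [e]
    exact sub_mem (neg_mem ih) (Submodule.mem_sup_right (hmul _ _))

/-- A nonzero `ZMod p`-representation of a finite `p`-group has a nonzero fixed vector. -/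
theorem exists_fixed_vector {p : ℕ} [Fact p.Prime] [Finite G] (hG : IsPGroup p G)
    {V : Type*} [AddCommGroup V] [Module (ZMod p) V] [DistribMulAction G V] [Nontrivial V] :
    ∃ v : V, v ≠ 0 ∧ ∀ g : G, g • v = v := by
  obtain ⟨a, ha⟩ := exists_ne (0 : V)
  let W : Submodule (ZMod p) V := Submodule.span (ZMod p) (Set.range fun g : G => g • a)
  have hfin : Module.Finite (ZMod p) ↥W :=
    Module.Finite.span_of_finite (ZMod p) (Set.finite_range fun g : G => g • a)
  have : Finite W := Module.finite_of_finite (ZMod p)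
  have hW : ∀ (g : G) (w : V), w ∈ W → g • w ∈ W := by
    intro g w hw
    induction hw using Submodule.span_induction with
    | mem w hw =>
      obtain ⟨h, rfl⟩ := hw
      exact Submodule.subset_span ⟨g * h, mul_smul g h a⟩
    | zero => simp
    | add x y _ _ hx hy => rw [smul_add]; exact add_mem hx hy
    | smul c x _ hx =>
      have := (DistribSMul.toAddMonoidHom V g).toZModLinearMap p |>.map_smul c x
      have e : g • c • x = c • g • x := this
      rw [e]
      exact Submodule.smul_mem _ c hx
  let _ : MulAction G W :=
    { smul := fun g w => ⟨g • (w : V), hW g w w.2⟩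
      one_smul := fun w => Subtype.ext (one_smul G (w : V))
      mul_smul := fun g h w => Subtype.ext (mul_smul g h (w : V)) }
  have haW : a ∈ W := Submodule.subset_span ⟨1, one_smul G a⟩
  have : Nontrivial W := ⟨⟨⟨a, haW⟩, 0, fun h => ha (Subtype.mk.inj h)⟩⟩
  have hcard : p ∣ Nat.card W := by
    have := Module.natCard_eq_pow_finrank (K := ZMod p) (V := W)
    rw [this, Nat.card_zmod]
    exact dvd_pow_self p Module.finrank_pos.ne'
  have h0 : (0 : W) ∈ MulAction.fixedPoints G W := fun g => Subtype.ext (smul_zero g)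
  obtain ⟨b, hb, hb0⟩ := hG.exists_fixed_point_of_prime_dvd_card_of_fixed_point W hcard h0
  refine ⟨b, fun h => hb0 (Subtype.ext h.symm), fun g => congrArg Subtype.val (hb g)⟩

theorem augmentationSpan_le_of_isMaximal {p : ℕ} [Fact p.Prime] [CharP K p] [Finite G]
    (hG : IsPGroup p G) (I : Ideal (MonoidAlgebra K G)) (hI : I.IsMaximal) :
    augmentationSpan K G ≤ I.restrictScalars K := by
  let _ : DistribMulAction G (MonoidAlgebra K G ⧸ I) :=
    DistribMulAction.compHom _ (of K G)
  have hnt : Nontrivial (MonoidAlgebra K G ⧸ I) := Submodule.Quotient.nontrivial_iff.2 hI.ne_top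
  let _ : Module (ZMod p) (MonoidAlgebra K G ⧸ I) := AddCommGroup.zmodModule (n := p) fun v => by
    rw [← Nat.cast_smul_eq_nsmul K, CharP.cast_eq_zero, zero_smul]
  obtain ⟨v, hv, hfix⟩ := exists_fixed_vector (V := MonoidAlgebra K G ⧸ I) hG
  obtain ⟨a, rfl⟩ := Submodule.Quotient.mk_surjective I v
  have haI : a ∉ I := fun h => hv ((Submodule.Quotient.mk_eq_zero I).2 h)
  have hga : ∀ g, (of K G g - 1) * a ∈ I := by
    intro g
    have := hfix g
    rw [sub_mul, one_mul]
    exact (Submodule.Quotient.eq I).1 this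
  have hJa : ∀ j ∈ augmentationSpan K G, j * a ∈ I := by
    intro j hj
    induction hj using Submodule.span_induction with
    | mem j hj => obtain ⟨g, rfl⟩ := hj; exact hga g
    | zero => simp
    | add x y _ _ hx hy => rw [add_mul]; exact add_mem hx hy
    | smul c x _ hx => rw [smul_mul_assoc]; exact (I.restrictScalars K).smul_mem c hx
  have htop : I ⊔ Ideal.span {a} = ⊤ := hI.1.2 _ (by
    refine lt_of_le_of_ne le_sup_left fun h => haI ?_
    rw [h]
    exact Submodule.mem_sup_right (Ideal.mem_span_singleton_self a))
  obtain ⟨m, hm, _, hb, h1⟩ := Submodule.mem_sup.1 ((Ideal.eq_top_iff_one _).1 htop)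
  obtain ⟨b, rfl⟩ := Ideal.mem_span_singleton'.1 hb
  obtain ⟨c, hc, j, hj, rfl⟩ := Submodule.mem_sup.1 (top_le_one_sup_augmentationSpan
    (Submodule.mem_top (x := b)))
  obtain ⟨k, rfl⟩ := Submodule.mem_one.1 hc
  rw [augmentationSpan, Submodule.span_le]
  rintro _ ⟨g, rfl⟩
  have e : of K G g - 1 = (of K G g - 1) * (m + j * a) + k • ((of K G g - 1) * a) := by
    rw [add_mul, ← Algebra.smul_def, add_comm (k • a), ← add_assoc] at h1
    rw [← mul_smul_comm, ← mul_add, h1, mul_one]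
  simp only [SetLike.mem_coe, Submodule.restrictScalars_mem]
  rw [e]
  exact add_mem (I.mul_mem_left _ (add_mem hm (hJa j hj)))
    ((I.restrictScalars K).smul_mem k (hga g))

theorem jacobson_eq_augmentationSpan {p : ℕ} [Fact p.Prime] [CharP K p] [Finite G]
    (hG : IsPGroup p G) :
    Submodule.restrictScalars K (⊥ : Ideal (MonoidAlgebra K G)).jacobson =
      augmentationSpan K G := by
  have hle : augmentationSpan K G ≤
      Submodule.restrictScalars K (⊥ : Ideal (MonoidAlgebra K G)).jacobson := by
    intro x hx
    simp only [Submodule.restrictScalars_mem, Ideal.jacobson, Submodule.mem_sInf]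
    rintro I ⟨-, hI⟩
    exact augmentationSpan_le_of_isMaximal hG I hI hx
  refine le_antisymm (fun x hx => ?_) hle
  obtain ⟨c, hc, j, hj, rfl⟩ := Submodule.mem_sup.1 (top_le_one_sup_augmentationSpan
    (Submodule.mem_top (x := x)))
  obtain ⟨k, rfl⟩ := Submodule.mem_one.1 hc
  by_cases hk : k = 0
  · simpa [hk] using hj
  exfalso
  have hmem : algebraMap K (MonoidAlgebra K G) k ∈
      Submodule.restrictScalars K (⊥ : Ideal (MonoidAlgebra K G)).jacobson :=
    (Submodule.add_mem_iff_left _ (hle hj)).1 hx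
  have htop := Ideal.eq_top_of_isUnit_mem _ hmem ((isUnit_iff_ne_zero.2 hk).map (algebraMap K _))
  rw [Ideal.jacobson_eq_top_iff] at htop
  exact bot_ne_top htop

theorem exists_augmentationSpan_pow_eq_bot {p : ℕ} [Fact p.Prime] [CharP K p] [Finite G]
    (hG : IsPGroup p G) : ∃ N, augmentationSpan K G ^ N = ⊥ := by
  have : IsArtinianRing (MonoidAlgebra K G) := IsArtinianRing.of_finite K _
  obtain ⟨n, hn⟩ := IsArtinianRing.isNilpotent_jacobson_bot (R := MonoidAlgebra K G)
  have key : ∀ m, augmentationSpan K G ^ (m + 1) ≤ Submodule.restrictScalars K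
      ((⊥ : Ideal (MonoidAlgebra K G)).jacobson ^ (m + 1)) := by
    intro m
    induction m with
    | zero => simp [← jacobson_eq_augmentationSpan hG, Submodule.pow_one]
    | succ m ih =>
      rw [pow_succ, Submodule.mul_le]
      intro a ha b hb
      rw [Submodule.restrictScalars_mem, Submodule.pow_succ]
      rw [← jacobson_eq_augmentationSpan hG] at hb
      exact Ideal.mul_mem_mul (ih ha) hb
  refine ⟨n + 1, eq_bot_iff.2 ((key n).trans ?_)⟩
  rw [Submodule.pow_succ, hn]
  simp

end Augmentation

theorem exists_generators_mem {K A : Type*} [Field K] [Ring A] [Algebra K A] {J : Submodule K A}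
    {S : Set A} (hS : Submodule.span K S = J) {u v : A}
    (hJ : J ≤ Submodule.span K {u, v} ⊔ J ^ 2) :
    ∃ a ∈ insert 0 S, ∃ b ∈ insert 0 S, J ≤ Submodule.span K {a, b} ⊔ J ^ 2 := by
  classical
  set π := (J ^ 2).mkQ with hπ
  have hle : Submodule.span K (π '' S) ≤
      Submodule.span K (({π u, π v} : Finset (A ⧸ J ^ 2)) : Set (A ⧸ J ^ 2)) := by
    rw [Submodule.span_image, hS]
    refine (Submodule.map_mono hJ).trans ?_
    rw [Submodule.map_sup, Submodule.map_span, Set.image_pair]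
    simp [hπ]
  have hfin : Module.Finite K (Submodule.span K (π '' S)) :=
    Submodule.finiteDimensional_of_le hle
  obtain ⟨f, hf, hspan, -⟩ := Submodule.exists_fun_fin_finrank_span_eq K (π '' S)
  have hr : Module.finrank K (Submodule.span K (π '' S)) ≤ 2 :=
    (Submodule.finrank_mono hle).trans ((finrank_span_finset_le_card _).trans Finset.card_le_two)
  generalize Module.finrank K (Submodule.span K (π '' S)) = r at f hr
  choose s hsS hsf using hf
  let c : ℕ → A := fun i => if h : i < r then s ⟨i, h⟩ else 0
  have hc : ∀ i, c i ∈ insert 0 S := by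
    intro i
    by_cases h : i < r
    · simp only [c, dif_pos h]; exact Or.inr (hsS _)
    · simp only [c, dif_neg h]; exact Or.inl rfl
  refine ⟨c 0, hc 0, c 1, hc 1, ?_⟩
  have hJmap : J.map π = Submodule.span K (π '' S) := by
    rw [Submodule.span_image, hS]
  have hmap : J.map π ≤ (Submodule.span K {c 0, c 1}).map π := by
    rw [hJmap, ← hspan, Submodule.span_le]
    rintro _ ⟨i, rfl⟩
    refine ⟨c i, Submodule.subset_span ?_, ?_⟩
    · have hi : (i : ℕ) = 0 ∨ (i : ℕ) = 1 := by omega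
      rcases hi with h | h <;> rw [h] <;> simp
    · simp only [c, dif_pos i.2]
      exact hsf i
  have := Submodule.map_le_iff_le_comap.1 hmap
  rwa [Submodule.comap_map_mkQ, sup_comm] at this

section GroupAlgebra

open MonoidAlgebra
open scoped commutatorElement

variable {K G : Type*} [Field K] [Group G]

theorem mul_mem_augmentationSpan_pow_right {n : ℕ} (hn : 1 ≤ n) {b : MonoidAlgebra K G}
    (hb : b ∈ augmentationSpan K G ^ n) (a : MonoidAlgebra K G) :
    b * a ∈ augmentationSpan K G ^ n :=
  Submodule.mul_mem_pow_right (J := augmentationSpan K G)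
    (augmentationSpan_mul_top (K := K) (G := G)) hn hb a

theorem mul_mem_augmentationSpan_pow_left {n : ℕ} (hn : 1 ≤ n) {b : MonoidAlgebra K G}
    (hb : b ∈ augmentationSpan K G ^ n) (a : MonoidAlgebra K G) :
    a * b ∈ augmentationSpan K G ^ n :=
  Submodule.mul_mem_pow_left (J := augmentationSpan K G)
    (top_mul_augmentationSpan (K := K) (G := G)) hn hb a

theorem of_mul_of_sub_of_mul_of (g h : G) :
    of K G g * of K G h - of K G h * of K G g = (of K G ⁅g, h⁆ - 1) * of K G (h * g) := by
  rw [sub_mul, one_mul, ← map_mul, ← map_mul, ← map_mul, commutatorElement_def]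
  congr 2
  group

theorem of_commutatorElement_sub_one_mem (g h : G) :
    of K G ⁅g, h⁆ - 1 ∈ augmentationSpan K G ^ 2 := by
  have e : of K G ⁅g, h⁆ - 1 = ((of K G g - 1) * (of K G h - 1) -
      (of K G h - 1) * (of K G g - 1)) * of K G (g⁻¹ * h⁻¹) := by
    have e1 : (of K G g - 1) * (of K G h - 1) - (of K G h - 1) * (of K G g - 1) =
        of K G g * of K G h - of K G h * of K G g := by noncomm_ring
    rw [e1, of_mul_of_sub_of_mul_of, mul_assoc, ← map_mul]
    simp only [mul_assoc, mul_inv_cancel_left, mul_inv_cancel, map_one, mul_one]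
  rw [e]
  refine mul_mem_augmentationSpan_pow_right one_le_two (sub_mem ?_ ?_) _
  all_goals
    rw [pow_two]
    exact Submodule.mul_mem_mul (of_sub_one_mem _) (of_sub_one_mem _)

theorem double_commutator_mem (hcent : commutator G ≤ Subgroup.center G)
    (x y z : MonoidAlgebra K G) :
    x * (y * z - z * y) - (y * z - z * y) * x ∈ augmentationSpan K G ^ 4 := by
  induction x using MonoidAlgebra.induction_on with
  | add x x' hx hx' =>
    convert add_mem hx hx' using 1
    noncomm_ring
  | smul r x hx =>
    convert Submodule.smul_mem _ r hx using 1
    simp only [smul_mul_assoc, mul_smul_comm, ← smul_sub]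
  | of g =>
  induction y using MonoidAlgebra.induction_on with
  | add x x' hx hx' =>
    convert add_mem hx hx' using 1
    noncomm_ring
  | smul r x hx =>
    convert Submodule.smul_mem _ r hx using 1
    simp only [smul_mul_assoc, mul_smul_comm, ← smul_sub]
  | of h =>
  induction z using MonoidAlgebra.induction_on with
  | add x x' hx hx' =>
    convert add_mem hx hx' using 1
    noncomm_ring
  | smul r x hx =>
    convert Submodule.smul_mem _ r hx using 1
    simp only [smul_mul_assoc, mul_smul_comm, ← smul_sub]
  | of k =>
  have hc : of K G g * of K G ⁅h, k⁆ = of K G ⁅h, k⁆ * of K G g := by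
    have := Subgroup.mem_center_iff.1 (hcent (Subgroup.commutator_mem_commutator
      (Subgroup.mem_top h) (Subgroup.mem_top k))) g
    rw [← map_mul, ← map_mul, this]
  have e : of K G g * (of K G h * of K G k - of K G k * of K G h) -
      (of K G h * of K G k - of K G k * of K G h) * of K G g =
      (of K G ⁅h, k⁆ - 1) * ((of K G ⁅g, k * h⁆ - 1) * of K G (k * h * g)) := by
    rw [← of_mul_of_sub_of_mul_of, of_mul_of_sub_of_mul_of h k, ← mul_assoc, mul_sub, hc]
    noncomm_ring
  rw [e]
  exact Submodule.mul_mem_pow_of_add_eq (of_commutatorElement_sub_one_mem h k)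
    (mul_mem_augmentationSpan_pow_right one_le_two
      (of_commutatorElement_sub_one_mem _ _) _) rfl

theorem card_le_of_span_eq_top {H : Type*} [Group H] [Finite H] {f : G →* H}
    (hf : Function.Surjective f) {S : Set (MonoidAlgebra K G)} (hS : Submodule.span K S = ⊤)
    {ι : Type*} [Fintype ι] (t : ι → MonoidAlgebra K H)
    (ht : ∀ s ∈ S, mapDomainAlgHom K K f s ∈ insert 0 (Set.range t)) :
    Nat.card H ≤ Fintype.card ι := by
  have hfr : Module.finrank K (MonoidAlgebra K H) = Nat.card H := by
    have := Fintype.ofFinite H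
    rw [(MonoidAlgebra.coeffLinearEquiv (S := K) (M := H) K).finrank_eq, Module.finrank_finsupp_self,
      Nat.card_eq_fintype_card]
  have htop : Submodule.span K (Set.range t) = ⊤ := by
    rw [eq_top_iff, ← span_range_of, Submodule.span_le]
    rintro _ ⟨h, rfl⟩
    obtain ⟨g, rfl⟩ := hf h
    have hg : of K G g ∈ Submodule.span K S := hS ▸ Submodule.mem_top
    have himg := Submodule.mem_map_of_mem (f := (mapDomainAlgHom K K f).toLinearMap) hg
    rw [Submodule.map_span] at himg
    have hle : Submodule.span K ((mapDomainAlgHom K K f).toLinearMap '' S) ≤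
        Submodule.span K (Set.range t) := by
      rw [Submodule.span_le]
      rintro _ ⟨s, hs, rfl⟩
      rcases ht s hs with h0 | h1
      · simp only [AlgHom.toLinearMap_apply, h0]
        exact zero_mem _
      · exact Submodule.subset_span h1
    have := hle himg
    simpa using this
  rw [← hfr, ← finrank_top K (MonoidAlgebra K H), ← htop]
  exact finrank_range_le_card t

theorem pow_eq_zero_of_exponent {p : ℕ} [Fact p.Prime] [CharP K p] {Q : Type*} [CommGroup Q]
    (f : G →* Q) {e : ℕ} (he : ∀ x : Q, x ^ p ^ e = 1) {a : MonoidAlgebra K G}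
    (ha : a ∈ augmentationSpan K G) : mapDomainAlgHom K K f a ^ p ^ e = 0 := by
  have : CharP (MonoidAlgebra K Q) p :=
    charP_of_injective_algebraMap (algebraMap K (MonoidAlgebra K Q)).injective p
  induction ha using Submodule.span_induction with
  | mem a ha =>
    obtain ⟨g, rfl⟩ := ha
    have e1 : mapDomainAlgHom K K f (of K G g - 1) = of K Q (f g) - 1 := by
      rw [map_sub, map_one]
      simp
    rw [e1, sub_pow_char_pow, ← map_pow, he, map_one, one_pow, sub_self]
  | zero => simp [(Fact.out : p.Prime).ne_zero]
  | add x y _ _ hx hy => rw [map_add, add_pow_char_pow, hx, hy, add_zero]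
  | smul c x _ hx => rw [map_smul, smul_pow, hx, smul_zero]

theorem not_span_pow_eq_top {p : ℕ} [Fact p.Prime] (hp : Odd p) [CharP K p] [Finite G]
    (hG : IsPGroup p G) (hnab : ∃ x y : G, x * y ≠ y * x)
    (hcent : commutator G ≤ Subgroup.center G) {a b : MonoidAlgebra K G}
    (ha : a ∈ augmentationSpan K G) (hb : b ∈ augmentationSpan K G) :
    Submodule.span K (Set.range (fun n : ℕ => a ^ n) ∪ Set.range (fun n : ℕ => b ^ n)) ≠ ⊤ := by
  intro hspan
  have hp' : p.Prime := Fact.out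
  have hp3 : 3 ≤ p := by
    obtain ⟨k, rfl⟩ := hp
    have := hp'.two_le
    omega
  have hsurj : Function.Surjective (Abelianization.of (G := G)) :=
    QuotientGroup.mk'_surjective _
  have hfin : Finite (Abelianization G) := Finite.of_surjective _ hsurj
  have hncyc : ¬ IsCyclic (Abelianization G) := by
    intro hcyc
    have := MonoidHom.isMulCommutative_of_isCyclic_of_ker_le_center (Abelianization.of (G := G))
      (by rwa [Abelianization.ker_of])
    obtain ⟨x, y, hxy⟩ := hnab
    exact hxy (mul_comm' x y)
  have hQ : IsPGroup p (Abelianization G) := hG.of_surjective _ hsurj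
  obtain ⟨k, hk⟩ := IsPGroup.iff_card.1 hQ
  obtain ⟨e, hek, he⟩ := (Nat.dvd_prime_pow hp').1
    (hk ▸ Group.exponent_dvd_nat_card (G := Abelianization G))
  have hlt : e < k := by
    refine lt_of_le_of_ne hek fun h => hncyc (IsCyclic.iff_exponent_eq_card.2 ?_)
    rw [he, hk, h]
  have hz : ∀ c ∈ augmentationSpan K G,
      mapDomainAlgHom K K (Abelianization.of (G := G)) c ^ p ^ e = 0 :=
    fun c hc => pow_eq_zero_of_exponent _ (fun x => he ▸ Monoid.pow_exponent_eq_one x) hc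
  have hcard := card_le_of_span_eq_top (K := K) hsurj hspan (ι := Fin (p ^ e) ⊕ Fin (p ^ e))
    (Sum.elim (fun i => mapDomainAlgHom K K (Abelianization.of (G := G)) a ^ (i : ℕ))
      (fun i => mapDomainAlgHom K K (Abelianization.of (G := G)) b ^ (i : ℕ))) (by
      rintro _ (⟨n, rfl⟩ | ⟨n, rfl⟩)
      all_goals
        simp only [map_pow]
        by_cases hn : n < p ^ e
      · exact Or.inr ⟨Sum.inl ⟨n, hn⟩, rfl⟩
      · exact Or.inl (pow_eq_zero_of_le (not_lt.1 hn) (hz a ha))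
      · exact Or.inr ⟨Sum.inr ⟨n, hn⟩, rfl⟩
      · exact Or.inl (pow_eq_zero_of_le (not_lt.1 hn) (hz b hb)))
  have h1 : p ^ (e + 1) ≤ p ^ k := Nat.pow_le_pow_right hp'.pos hlt
  have h2 : 0 < p ^ e := pow_pos hp'.pos e
  simp only [hk, Fintype.card_sum, Fintype.card_fin] at hcard
  rw [pow_succ] at h1
  nlinarith

/-- The third dimension subgroup `{g | g - 1 ∈ J ^ 3}` of `G`, where `J` is the augmentation
ideal. -/
def dimensionSubgroupThree (K G : Type*) [Field K] [Group G] : Subgroup G where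
  carrier := {g | of K G g - 1 ∈ augmentationSpan K G ^ 3}
  one_mem' := by simp only [Set.mem_ofPred_eq, map_one, sub_self]; exact zero_mem _
  mul_mem' := by
    intro g h hg hh
    have e : of K G (g * h) - 1 = (of K G g - 1) * of K G h + (of K G h - 1) := by
      rw [map_mul]; noncomm_ring
    simp only [Set.mem_ofPred_eq]
    rw [e]
    exact add_mem (mul_mem_augmentationSpan_pow_right (by norm_num) hg _) hh
  inv_mem' := by
    intro g hg
    have h1 : of K G g⁻¹ * of K G g = 1 := by rw [← map_mul, inv_mul_cancel, map_one]
    have e : of K G g⁻¹ - 1 = -(of K G g⁻¹ * (of K G g - 1)) := by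
      rw [mul_sub, h1]; noncomm_ring
    simp only [Set.mem_ofPred_eq]
    rw [e]
    exact neg_mem (mul_mem_augmentationSpan_pow_left (by norm_num) hg _)

theorem mem_dimensionSubgroupThree {g : G} :
    g ∈ dimensionSubgroupThree K G ↔ of K G g - 1 ∈ augmentationSpan K G ^ 3 := Iff.rfl

instance dimensionSubgroupThree_normal : (dimensionSubgroupThree K G).Normal where
  conj_mem n hn g := by
    have h1 : of K G g * of K G g⁻¹ = 1 := by rw [← map_mul, mul_inv_cancel, map_one]
    have e : of K G (g * n * g⁻¹) - 1 = of K G g * (of K G n - 1) * of K G g⁻¹ := by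
      rw [mul_sub, sub_mul, mul_one, h1, map_mul, map_mul]
    rw [mem_dimensionSubgroupThree, e]
    exact mul_mem_augmentationSpan_pow_right (by norm_num)
      (mul_mem_augmentationSpan_pow_left (by norm_num) hn _) _

theorem pow_mem_dimensionSubgroupThree {p : ℕ} [Fact p.Prime] [CharP K p] (hp3 : 3 ≤ p) (g : G) :
    g ^ p ∈ dimensionSubgroupThree K G := by
  have : CharP (MonoidAlgebra K G) p :=
    charP_of_injective_algebraMap (algebraMap K (MonoidAlgebra K G)).injective p
  have e : of K G (g ^ p) - 1 = (of K G g - 1) ^ p := by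
    rw [sub_pow_char_of_commute p (Commute.one_right _), one_pow, map_pow]
  rw [mem_dimensionSubgroupThree, e]
  exact Submodule.pow_le_pow_of_mul_le (augmentationSpan_mul_self (K := K) (G := G))
    (by norm_num) hp3
    (Submodule.pow_mem_pow _ (of_sub_one_mem g) p)

theorem commutator_mem_of_quotient_comm
    (h : ∀ x y : G ⧸ dimensionSubgroupThree K G, x * y = y * x) (x y : MonoidAlgebra K G) :
    x * y - y * x ∈ augmentationSpan K G ^ 3 := by
  induction x using MonoidAlgebra.induction_on with
  | add x x' hx hx' =>
    convert add_mem hx hx' using 1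
    noncomm_ring
  | smul r x hx =>
    convert Submodule.smul_mem _ r hx using 1
    simp only [smul_mul_assoc, mul_smul_comm, ← smul_sub]
  | of g =>
  induction y using MonoidAlgebra.induction_on with
  | add x x' hx hx' =>
    convert add_mem hx hx' using 1
    noncomm_ring
  | smul r x hx =>
    convert Submodule.smul_mem _ r hx using 1
    simp only [smul_mul_assoc, mul_smul_comm, ← smul_sub]
  | of k =>
  rw [of_mul_of_sub_of_mul_of]
  refine mul_mem_augmentationSpan_pow_right (by norm_num) ?_ _
  rw [← mem_dimensionSubgroupThree, ← QuotientGroup.eq_one_iff, commutatorElement_def]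
  simp only [QuotientGroup.mk_mul, QuotientGroup.mk_inv]
  rw [h (g : G ⧸ dimensionSubgroupThree K G) k]
  group

theorem IsPGroup.pow_three_le_card {p : ℕ} [Fact p.Prime] [Finite G] (hG : IsPGroup p G)
    (hnab : ¬ ∀ x y : G, x * y = y * x) : p ^ 3 ≤ Nat.card G := by
  obtain ⟨n, hn⟩ := IsPGroup.iff_card.1 hG
  rw [hn]
  refine Nat.pow_le_pow_right (Fact.out : p.Prime).pos ?_
  by_contra! hlt
  refine hnab fun x y => ?_
  rcases (by omega : n = 0 ∨ n = 1 ∨ n = 2) with rfl | rfl | rfl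
  · rw [pow_zero, Nat.card_eq_one_iff_unique] at hn
    have := hn.1
    exact Subsingleton.elim _ _
  · rw [pow_one] at hn
    have := isCyclic_of_prime_card hn
    exact IsCyclic.commGroup.mul_comm x y
  · have := IsPGroup.isMulCommutative_of_card_eq_prime_sq hn
    exact mul_comm' x y

theorem not_span_ordered_monomials_eq_top {p : ℕ} [Fact p.Prime] [CharP K p] (hp3 : 3 ≤ p)
    [Finite G] (hG : IsPGroup p G)
    (hnab : ¬ ∀ x y : G ⧸ dimensionSubgroupThree K G, x * y = y * x) (x y : G) :
    Submodule.span K (insert ((of K G y - 1) * (of K G x - 1))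
      (Set.range fun n : ℕ × ℕ => (of K G x - 1) ^ n.1 * (of K G y - 1) ^ n.2)) ≠ ⊤ := by
  intro hspan
  have hcard3 := (hG.to_quotient (dimensionSubgroupThree K G)).pow_three_le_card hnab
  set f := QuotientGroup.mk' (dimensionSubgroupThree K G) with hf
  set φ := mapDomainAlgHom K K f with hφ
  have : CharP (MonoidAlgebra K (G ⧸ dimensionSubgroupThree K G)) p :=
    charP_of_injective_algebraMap
      (algebraMap K (MonoidAlgebra K (G ⧸ dimensionSubgroupThree K G))).injective p
  have hz : ∀ g : G, φ (of K G g - 1) ^ p = 0 := by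
    intro g
    have e1 : φ (of K G g - 1) = of K _ (f g) - 1 := by
      rw [map_sub, map_one]
      simp [hφ]
    have e2 : f g ^ p = 1 := by
      rw [← map_pow]
      exact (QuotientGroup.eq_one_iff _).2 (pow_mem_dimensionSubgroupThree hp3 g)
    rw [e1, sub_pow_char_of_commute p (Commute.one_right _), one_pow, ← map_pow, e2, map_one,
      sub_self]
  have hcard := card_le_of_span_eq_top (K := K) (QuotientGroup.mk'_surjective _) hspan
    (ι := Option (Fin p × Fin p))
    (fun o => o.elim (φ ((of K G y - 1) * (of K G x - 1)))
      fun n => φ (of K G x - 1) ^ (n.1 : ℕ) * φ (of K G y - 1) ^ (n.2 : ℕ)) (by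
      rintro _ (rfl | ⟨⟨i, j⟩, rfl⟩)
      · exact Or.inr ⟨none, rfl⟩
      · simp only [map_mul, map_pow, ← hf, ← hφ]
        by_cases hi : i < p
        · by_cases hj : j < p
          · exact Or.inr ⟨some (⟨i, hi⟩, ⟨j, hj⟩), rfl⟩
          · exact Or.inl (by rw [pow_eq_zero_of_le (not_lt.1 hj) (hz y), mul_zero])
        · exact Or.inl (by rw [pow_eq_zero_of_le (not_lt.1 hi) (hz x), zero_mul]))
  simp only [Fintype.card_option, Fintype.card_prod, Fintype.card_fin] at hcard
  have := hcard3.trans hcard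
  nlinarith [Nat.mul_le_mul hp3 (Nat.mul_le_mul hp3 hp3), Nat.mul_le_mul_right (p * p) hp3]

end GroupAlgebra

/-- If `p` is odd, `K` a field of characteristic `p`, and `G` a finite nonabelian
`p`-group generated by two elements whose commutator subgroup is cyclic and central,
then `KG` has no filtered multiplicative `K`-basis. -/
theorem no_filtered_mult_basis_two_generated (p : ℕ) [Fact p.Prime] (hp : Odd p)
    (K : Type*) [Field K] [CharP K p]
    (G : Type*) [Group G] [Fintype G] (hG : IsPGroup p G)
    (hnab : ∃ x y : G, x * y ≠ y * x)
    (hgen : ∃ x y : G, Subgroup.closure {x, y} = (⊤ : Subgroup G))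
    (hcyc : IsCyclic (commutator G))
    (hcent : commutator G ≤ Subgroup.center G) :
    ¬ ∃ B : Set (MonoidAlgebra K G), IsFilteredMultiplicativeBasis K B := by
  rintro ⟨B, hli, hspan, hmul, -, hrad⟩
  have hp3 : 3 ≤ p := by
    obtain ⟨k, rfl⟩ := hp
    have := (Fact.out : (2 * k + 1).Prime).two_le
    omega
  have h2 : (2 : K) ≠ 0 := by
    intro h
    have := (CharP.cast_eq_zero_iff K p 2).1 (by exact_mod_cast h)
    exact absurd (Nat.le_of_dvd two_pos this) (by omega)
  obtain ⟨x, y, hxy⟩ := hgen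
  have hB : Submodule.span K (B ∩ augmentationSpan K G) = augmentationSpan K G := by
    rw [jacobson_eq_augmentationSpan hG] at hrad
    rw [← hrad]
    congr 2
    rw [hrad, ← jacobson_eq_augmentationSpan hG]
    rfl
  have h1 := top_le_one_sup_augmentationSpan (K := K) (G := G)
  have hJJ := augmentationSpan_mul_self (K := K) (G := G)
  obtain ⟨N, hN⟩ := exists_augmentationSpan_pow_eq_bot (K := K) hG
  have hgenJ := augmentationSpan_le_of_closure (K := K) hxy
  obtain ⟨a, ha, b, hb, hab⟩ := exists_generators_mem hB hgenJ
  have hpow : ∀ n, 1 ≤ n → _ := fun n hn => pow_le_span_inter (n := n) hmul hB hn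
  have hM : ∀ s ∈ insert 0 B, ∀ t ∈ insert 0 B, s * t ∈ insert 0 B := by
    rintro s (rfl | hs) t (rfl | ht)
    · exact Or.inl (mul_zero _)
    · exact Or.inl (zero_mul _)
    · exact Or.inl (mul_zero _)
    · exact hmul s hs t ht
  have haB : a ∈ insert 0 B := ha.imp_right And.left
  have hbB : b ∈ insert 0 B := hb.imp_right And.left
  have haJ : a ∈ augmentationSpan K G := by
    rcases ha with rfl | ha
    exacts [zero_mem _, ha.2]
  have hbJ : b ∈ augmentationSpan K G := by
    rcases hb with rfl | hb
    exacts [zero_mem _, hb.2]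
  by_cases hcomm : a * b - b * a ∈ augmentationSpan K G ^ 3
  · rcases eq_or_mem_of_sub_mem hli hspan (hpow 3 (by norm_num)) (hM a haB b hbB) (hM b hbB a haB)
      hcomm with h | ⟨h, h'⟩
    · obtain ⟨g, k, hgk⟩ := hnab
      have := Submodule.commute_of_generators h1 hJJ hN hab h (MonoidAlgebra.of K G g)
        (MonoidAlgebra.of K G k)
      rw [← map_mul, ← map_mul] at this
      exact hgk (MonoidAlgebra.of_injective this)
    · exact not_span_pow_eq_top hp hG hnab hcent haJ hbJ
        (Submodule.span_pow_eq_top h1 hJJ hN haJ hbJ hab h h')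
  · have ha4 : (a * b - b * a) * a ∈ augmentationSpan K G ^ 4 := by
      have := sub_mem_of_second_difference_mem h2 hli hspan (hpow 4 (by norm_num))
        (hM b hbB _ (hM a haB a haB)) (hM _ (hM a haB b hbB) a haB) (hM _ (hM a haB a haB) b hbB)
        (by
          convert double_commutator_mem (K := K) hcent a a b using 1
          noncomm_ring)
      convert neg_mem this using 1
      noncomm_ring
    have hb4 : (a * b - b * a) * b ∈ augmentationSpan K G ^ 4 := by
      have := sub_mem_of_second_difference_mem h2 hli hspan (hpow 4 (by norm_num))
        (hM a haB _ (hM b hbB b hbB)) (hM _ (hM b hbB a haB) b hbB) (hM _ (hM b hbB b hbB) a haB)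
        (by
          convert double_commutator_mem (K := K) hcent b b a using 1
          noncomm_ring)
      convert this using 1
      noncomm_ring
    have hx := of_sub_one_mem (K := K) x
    have hy := of_sub_one_mem (K := K) y
    have hl := fun c hc => commutator_mul_mem_of_generators hJJ haJ hbJ hab ha4 hb4 hy hx
      (z := c) hc
    refine not_span_ordered_monomials_eq_top (K := K) hp3 hG
      (fun h => hcomm (commutator_mem_of_quotient_comm h a b)) x y
      (Submodule.span_ordered_monomials_eq_top h1 hJJ hN hx hy hgenJ hl fun c hc => ?_)
    have := add_mem (hl c hc) (double_commutator_mem hcent c (MonoidAlgebra.of K G y - 1)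
      (MonoidAlgebra.of K G x - 1))
    rwa [add_sub_cancel] at this
end

section
/- Let K be a field of characteristic p and let G be a finite abelian p-group written as a direct product G = <a_1> x <a_2> x ... x <a_s> of cyclic groups, where a_i has order q_i. Then the set B = { (a_1 - 1)^{n_1} (a_2 - 1)^{n_2} ... (a_s - 1)^{n_s} : 0 <= n_i < q_i } is a filtered multiplicative K-basis of the group algebra KG. -/
section TruncatedMonomials

variable {K A ι : Type*} [Field K] [CommRing A] [Algebra K A] [Fintype ι]

/-- Monomials `∏ xᵢ ^ nᵢ` with `nᵢ < qᵢ` multiply to zero or to such a monomial, provided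
`xᵢ ^ qᵢ = 0`. -/
theorem truncatedMonomials_mul {x : ι → A} {q : ι → ℕ} (hx : ∀ i, x i ^ q i = 0)
    (n m : (i : ι) → Fin (q i)) :
    (∏ i, x i ^ (n i : ℕ)) * ∏ i, x i ^ (m i : ℕ) = 0 ∨
      ∃ k : (i : ι) → Fin (q i),
        (∏ i, x i ^ (n i : ℕ)) * ∏ i, x i ^ (m i : ℕ) = ∏ i, x i ^ (k i : ℕ) := by
  simp only [← Finset.prod_mul_distrib, ← pow_add]
  by_cases h : ∀ i, (n i + m i : ℕ) < q i
  · exact Or.inr ⟨fun i => ⟨_, h i⟩, rfl⟩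
  · push Not at h
    obtain ⟨i, hi⟩ := h
    exact Or.inl (Finset.prod_eq_zero (Finset.mem_univ i) (pow_eq_zero_of_le hi (hx i)))

/-- If the `xᵢ` generate `A` and `xᵢ ^ qᵢ = 0`, then the monomials `∏ xᵢ ^ nᵢ` with `nᵢ < qᵢ`
span `A`. -/
theorem span_truncatedMonomials {x : ι → A} {q : ι → ℕ} (hq : ∀ i, 0 < q i)
    (hx : ∀ i, x i ^ q i = 0) (hgen : Algebra.adjoin K (Set.range x) = ⊤) :
    Submodule.span K {y : A | ∃ n : (i : ι) → Fin (q i), y = ∏ i, x i ^ (n i : ℕ)} = ⊤ := by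
  classical
  set B := {y : A | ∃ n : (i : ι) → Fin (q i), y = ∏ i, x i ^ (n i : ℕ)}
  have hone : (1 : A) ∈ Submodule.span K B :=
    Submodule.subset_span ⟨fun i => ⟨0, hq i⟩, by simp⟩
  have hmul : ∀ y z, y ∈ Submodule.span K B → z ∈ Submodule.span K B →
      y * z ∈ Submodule.span K B := by
    intro y z hy hz
    have hyz := Submodule.mul_mem_mul hy hz
    rw [Submodule.span_mul_span] at hyz
    refine Submodule.span_le.2 ?_ hyz
    rintro _ ⟨_, ⟨n, rfl⟩, _, ⟨m, rfl⟩, rfl⟩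
    rcases truncatedMonomials_mul hx n m with h | h
    · simp [h]
    · exact Submodule.subset_span h
  have hle : Algebra.adjoin K (Set.range x) ≤ (Submodule.span K B).toSubalgebra hone hmul := by
    refine Algebra.adjoin_le ?_
    rintro _ ⟨i, rfl⟩
    change x i ∈ Submodule.span K B
    rcases Nat.lt_or_ge 1 (q i) with h | h
    · refine Submodule.subset_span
        ⟨fun j => if hj : j = i then ⟨1, hj ▸ h⟩ else ⟨0, hq j⟩, ?_⟩
      rw [Finset.prod_eq_single i]
      · simp
      · intro j _ hj
        simp [hj]
      · simp
    · have : x i = 0 := by simpa using pow_eq_zero_of_le h (hx i)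
      simp [this]
  rw [hgen] at hle
  exact eq_top_iff.2 fun y _ => hle (Algebra.mem_top : y ∈ ⊤)

/-- If the nilpotent elements `xᵢ`, with `xᵢ ^ qᵢ = 0`, generate the algebra `A` of dimension
`∏ qᵢ`, then the monomials `∏ xᵢ ^ nᵢ` with `nᵢ < qᵢ` are a filtered multiplicative basis. -/
theorem isFilteredMultiplicativeBasis_truncatedMonomials {x : ι → A} {q : ι → ℕ}
    (hq : ∀ i, 0 < q i) (hx : ∀ i, x i ^ q i = 0)
    (hgen : Algebra.adjoin K (Set.range x) = ⊤) (hdim : Module.finrank K A = ∏ i, q i) :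
    IsFilteredMultiplicativeBasis K
      {y : A | ∃ n : (i : ι) → Fin (q i), y = ∏ i, x i ^ (n i : ℕ)} := by
  classical
  have hspan := span_truncatedMonomials hq hx hgen
  set B := {y : A | ∃ n : (i : ι) → Fin (q i), y = ∏ i, x i ^ (n i : ℕ)} with hB
  have hrange : B = Set.range fun n : (i : ι) → Fin (q i) => ∏ i, x i ^ (n i : ℕ) := by
    ext y
    simp [hB, eq_comm]
  have hli : LinearIndependent K ((↑) : B → A) := by
    rw [hrange]
    refine (linearIndependent_of_top_le_span_of_card_eq_finrank ?_ ?_).linearIndepOn_id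
    · rw [← hrange, hspan]
    · simp [hdim]
  have : Nontrivial A := Module.nontrivial_of_finrank_pos (R := K)
    (hdim ▸ Finset.prod_pos fun i _ => hq i)
  set J : Ideal A := (⊥ : Ideal A).jacobson
  have hsub : B ⊆ insert 1 (B ∩ (J : Set A)) := by
    rintro y ⟨n, rfl⟩
    by_cases h : ∀ i, (n i : ℕ) = 0
    · exact Or.inl (by simp [h])
    · push Not at h
      obtain ⟨i, hi⟩ := h
      have hnil : IsNilpotent (x i) := ⟨q i, hx i⟩
      have hxi : x i ∈ J := Ideal.radical_le_jacobson (mem_nilradical.2 hnil)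
      exact Or.inr ⟨⟨n, rfl⟩, J.mem_of_dvd
        (Finset.dvd_prod_of_mem _ (Finset.mem_univ i)) (J.pow_mem_of_mem hxi _ (by omega))⟩
  have hle : Submodule.span K (B ∩ (J : Set A)) ≤ J.restrictScalars K :=
    Submodule.span_le.2 Set.inter_subset_right
  refine ⟨hli, hspan, ?_, LinearIndepOn.mono (v := id) hli Set.inter_subset_left, le_antisymm hle fun y hy => ?_⟩
  · rintro _ ⟨n, rfl⟩ _ ⟨m, rfl⟩
    exact truncatedMonomials_mul hx n m
  · have hy' : y ∈ Submodule.span K (insert 1 (B ∩ (J : Set A))) :=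
      Submodule.span_mono hsub (hspan ▸ Submodule.mem_top)
    obtain ⟨c, z, hz, rfl⟩ := Submodule.mem_span_insert.1 hy'
    have hc : c • (1 : A) ∈ J := by
      simpa using J.sub_mem hy (hle hz)
    have : c = 0 := by
      by_contra hc0
      have h1 : (1 : A) ∈ J := by
        simpa [smul_smul, hc0] using (J.restrictScalars K).smul_mem c⁻¹ hc
      exact bot_ne_top (Ideal.jacobson_eq_top_iff.1 ((Ideal.eq_top_iff_one J).2 h1))
    simpa [this] using hz

end TruncatedMonomials

/-- If `G` is a finite abelian `p`-group, written as the (internal) direct product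
`G = ⟨a₁⟩ × ⋯ × ⟨aₛ⟩` of cyclic groups where `aᵢ` has order `qᵢ`, and `K` is a field
of characteristic `p`, then
`B = {(a₁-1)^{n₁} ⋯ (aₛ-1)^{nₛ} : 0 ≤ nᵢ < qᵢ}`
is a filtered multiplicative `K`-basis of `KG`. -/
theorem filtered_mult_basis_of_abelian (p : ℕ) [Fact p.Prime]
    (K : Type*) [Field K] [CharP K p]
    (G : Type*) [CommGroup G] [Fintype G] (hG : IsPGroup p G)
    (s : ℕ) (a : Fin s → G) (q : Fin s → ℕ) (horder : ∀ i, orderOf (a i) = q i)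
    (hdirect : Function.Bijective
      (fun n : (i : Fin s) → Fin (q i) => ∏ i, a i ^ (n i : ℕ))) :
    IsFilteredMultiplicativeBasis K
      { x : MonoidAlgebra K G | ∃ n : (i : Fin s) → Fin (q i),
          x = ∏ i, (MonoidAlgebra.of K G (a i) - 1) ^ (n i : ℕ) } := by
  refine isFilteredMultiplicativeBasis_truncatedMonomials
    (x := fun i => MonoidAlgebra.of K G (a i) - 1) (fun i => horder i ▸ orderOf_pos _) ?_ ?_ ?_
  · intro i
    obtain ⟨k, hk⟩ := IsPGroup.iff_orderOf.1 hG (a i)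
    have : CharP (MonoidAlgebra K G) p := charP_of_injective_algebraMap' K p
    rw [← horder i, hk, sub_pow_char_pow, ← map_pow, ← hk, pow_orderOf_eq_one,
      map_one, one_pow, sub_self]
  · set S := Algebra.adjoin K (Set.range fun i => MonoidAlgebra.of K G (a i) - 1)
    have ha : ∀ i, MonoidAlgebra.of K G (a i) ∈ S := fun i => by
      simpa using S.add_mem (Algebra.subset_adjoin (Set.mem_range_self i)) S.one_mem
    have hg : ∀ g, MonoidAlgebra.of K G g ∈ S := fun g => by
      obtain ⟨n, rfl⟩ := hdirect.2 g
      simp only [map_prod, map_pow]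
      exact S.prod_mem fun i _ => S.pow_mem (ha i) _
    refine eq_top_iff.2 fun y _ => ?_
    induction y using MonoidAlgebra.induction_on with
    | of g => exact hg g
    | add f g hf hg => exact S.add_mem (hf trivial) (hg trivial)
    | smul r f hf => exact S.smul_mem (hf trivial) r
  · have hcard := Fintype.card_of_bijective hdirect
    simp only [Fintype.card_pi, Fintype.card_fin] at hcard
    rw [hcard]
    exact (MonoidAlgebra.coeffLinearEquiv K).finrank_eq.trans (Module.finrank_finsupp_self K)
end

section
/- Let K be a field and let G_1 and G_2 be finite groups. If B_1 is a filtered multiplicative K-basis of the group algebra KG_1 and B_2 is a filtered multiplicative K-basis of the group algebra KG_2, then the set { b_1 * b_2 : b_1 in B_1, b_2 in B_2 } (where B_1 and B_2 are viewed inside K[G_1 x G_2] via the canonical embeddings of KG_1 and KG_2) is a filtered multiplicative K-basis of the group algebra K[G_1 x G_2]. -/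
section

open TensorProduct
open scoped Pointwise

/-- An element `∑ xᵢ ⊗ yᵢ` of `A ⊗ A` is a *separability element* if `∑ xᵢ yᵢ = 1` and
`∑ a xᵢ ⊗ yᵢ = ∑ xᵢ ⊗ yᵢ a` for all `a`. -/
def IsSeparabilityElement (F : Type*) {A : Type*} [CommRing F] [Ring A] [Algebra F A]
    (e : A ⊗[F] A) : Prop :=
  LinearMap.mul' F A e = 1 ∧ ∀ a : A, (a ⊗ₜ[F] (1 : A)) * e = e * ((1 : A) ⊗ₜ[F] a)

namespace IsSeparabilityElement

/-- Separability elements push forward along a homomorphism whose image spans the target. -/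
theorem exists_of_span_range_eq_top {F K A C : Type*} [CommRing F] [CommRing K] [Algebra F K]
    [Ring A] [Algebra F A] [Ring C] [Algebra F C] [Algebra K C] [IsScalarTower F K C]
    {e : A ⊗[F] A} (he : IsSeparabilityElement F e) (φ : A →ₐ[F] C)
    (hφ : Submodule.span K (Set.range φ) = ⊤) :
    ∃ e' : C ⊗[K] C, IsSeparabilityElement K e' := by
  let T : A ⊗[F] A →ₐ[F] C ⊗[K] C := Algebra.TensorProduct.lift
    (((Algebra.TensorProduct.includeLeft : C →ₐ[K] C ⊗[K] C).restrictScalars F).comp φ)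
    (((Algebra.TensorProduct.includeRight : C →ₐ[K] C ⊗[K] C).restrictScalars F).comp φ)
    (fun a b => by simp [commute_iff_eq])
  have hT (a b : A) : T (a ⊗ₜ b) = φ a ⊗ₜ φ b := by
    refine (Algebra.TensorProduct.lift_tmul _ _ _ a b).trans ?_
    simp
  refine ⟨T e, ?_, fun c => ?_⟩
  · have h (z : A ⊗[F] A) : LinearMap.mul' K C (T z) = φ (LinearMap.mul' F A z) := by
      induction z with
      | zero => simp
      | tmul x y => simp [hT]
      | add x y hx hy => simp [hx, hy]
    rw [h, he.1, map_one]
  · have hc : c ∈ Submodule.span K (Set.range φ) := hφ ▸ Submodule.mem_top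
    induction hc using Submodule.span_induction with
    | mem x hx =>
      obtain ⟨a, rfl⟩ := hx
      have h := congrArg T (he.2 a)
      simpa [map_mul, hT] using h
    | zero => simp
    | add x y _ _ hx hy => rw [add_tmul, tmul_add, add_mul, mul_add, hx, hy]
    | smul k x _ hx =>
      rw [tmul_smul, ← smul_tmul', smul_mul_assoc, mul_smul_comm, hx]

/-- The tensor product of two algebras with separability elements has a separability element. -/
theorem exists_tensorProduct {K C D : Type*} [CommRing K] [Ring C] [Algebra K C] [Ring D]
    [Algebra K D] {e : C ⊗[K] C} {f : D ⊗[K] D} (he : IsSeparabilityElement K e)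
    (hf : IsSeparabilityElement K f) :
    ∃ g : (C ⊗[K] D) ⊗[K] (C ⊗[K] D), IsSeparabilityElement K g := by
  let T := Algebra.TensorProduct.tensorTensorTensorComm K K K K C C D D
  have hT (a b : C) (c d : D) : T ((a ⊗ₜ b) ⊗ₜ (c ⊗ₜ d)) = (a ⊗ₜ c) ⊗ₜ (b ⊗ₜ d) := rfl
  refine ⟨T (e ⊗ₜ f), ?_, fun x => ?_⟩
  · have h (z : C ⊗[K] C) (w : D ⊗[K] D) : LinearMap.mul' K (C ⊗[K] D) (T (z ⊗ₜ w)) =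
        LinearMap.mul' K C z ⊗ₜ LinearMap.mul' K D w := by
      induction z with
      | zero => simp
      | add x y hx hy => simp [add_tmul, hx, hy]
      | tmul a b =>
        induction w with
        | zero => simp
        | add x y hx hy => simp [tmul_add, hx, hy]
        | tmul c d => simp [hT]
    rw [h, he.1, hf.1, Algebra.TensorProduct.one_def]
  · induction x with
    | zero => simp
    | add x y hx hy => rw [add_tmul, tmul_add, add_mul, mul_add, hx, hy]
    | tmul c d =>
      have h1 : ((c ⊗ₜ[K] d) ⊗ₜ[K] (1 : C ⊗[K] D)) = T ((c ⊗ₜ 1) ⊗ₜ (d ⊗ₜ 1)) := by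
        rw [hT, Algebra.TensorProduct.one_def]
      have h2 : ((1 : C ⊗[K] D) ⊗ₜ[K] (c ⊗ₜ[K] d)) = T ((1 ⊗ₜ c) ⊗ₜ (1 ⊗ₜ d)) := by
        rw [hT, Algebra.TensorProduct.one_def]
      rw [h1, h2, ← map_mul, ← map_mul, Algebra.TensorProduct.tmul_mul_tmul,
        Algebra.TensorProduct.tmul_mul_tmul, he.2, hf.2]

/-- An algebra over a field with a separability element is semisimple. -/
theorem isSemisimpleRing {K C : Type*} [Field K] [Ring C] [Algebra K C] {e : C ⊗[K] C}
    (he : IsSeparabilityElement K e) : IsSemisimpleRing C := by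
  refine (isSemisimpleModule_iff C C).mpr ⟨fun N => ?_⟩
  obtain ⟨Q, hQ⟩ := (N.restrictScalars K).exists_isCompl
  let π : C →ₗ[K] C := (N.restrictScalars K).projection Q hQ
  have hπ : LinearMap.IsProj (N.restrictScalars K) π :=
    ⟨fun x => Submodule.projection_apply_mem hQ x,
      fun x hx => Submodule.projection_apply_left hQ ⟨x, hx⟩⟩
  let Ψ : C ⊗[K] C →ₗ[K] Module.End K C :=
    TensorProduct.lift ((LinearMap.mul K (Module.End K C)).compl₁₂
      (LinearMap.mul K C) ((LinearMap.mulLeft K π).comp (LinearMap.mul K C)))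
  have hΨ (x y m : C) : Ψ (x ⊗ₜ y) m = x * π (y * m) := by simp [Ψ]
  have hleft (a m : C) (z : C ⊗[K] C) : Ψ ((a ⊗ₜ 1) * z) m = a * Ψ z m := by
    induction z with
    | zero => simp
    | tmul x y => simp [hΨ, mul_assoc]
    | add x y hx hy => simp only [mul_add, map_add, LinearMap.add_apply, hx, hy]
  have hright (a m : C) (z : C ⊗[K] C) : Ψ (z * (1 ⊗ₜ a)) m = Ψ z (a * m) := by
    induction z with
    | zero => simp
    | tmul x y => simp [hΨ, mul_assoc]
    | add x y hx hy => simp only [add_mul, map_add, LinearMap.add_apply, hx, hy]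
  have hmem (m : C) (z : C ⊗[K] C) : Ψ z m ∈ N := by
    induction z with
    | zero => simp
    | tmul x y => rw [hΨ]; exact N.smul_mem x (hπ.map_mem (y * m))
    | add x y hx hy => simpa only [map_add, LinearMap.add_apply] using N.add_mem hx hy
  have hid (m : C) (hm : m ∈ N) (z : C ⊗[K] C) : Ψ z m = LinearMap.mul' K C z * m := by
    induction z with
    | zero => simp
    | tmul x y =>
      rw [hΨ, hπ.map_id (y * m) (N.smul_mem y hm), LinearMap.mul'_apply, mul_assoc]
    | add x y hx hy => simp only [map_add, LinearMap.add_apply, add_mul, hx, hy]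
  let p : C →ₗ[C] N :=
    { toFun := fun m => ⟨Ψ e m, hmem m e⟩
      map_add' := fun x y => Subtype.ext (map_add (Ψ e) x y)
      map_smul' := fun a x => Subtype.ext <| by
        change Ψ e (a * x) = a * Ψ e x
        rw [← hright, ← he.2, hleft] }
  exact ⟨_, LinearMap.isCompl_of_proj (f := p) fun m => Subtype.ext <| by
    change Ψ e m = m
    rw [hid m m.2, he.1, one_mul]⟩

/-- A finite extension of a finite field has a separability element. -/
theorem exists_of_finite_field (F D : Type*) [Field F] [Finite F] [Field D] [Algebra F D]
    [Module.Finite F D] : ∃ e : D ⊗[F] D, IsSeparabilityElement F e := by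
  have := Algebra.FormallyUnramified.of_isSeparable F D
  refine ⟨Algebra.FormallyUnramified.elem F D, ?_, fun a => ?_⟩
  · rw [← Algebra.FormallyUnramified.lmul_elem (R := F) (S := D)]
    rfl
  · rw [← Algebra.FormallyUnramified.one_tmul_mul_elem, mul_comm]

/-- A finite division algebra over a finite field has a separability element. -/
theorem exists_of_finite_divisionRing (F D : Type*) [Field F] [Finite F] [DivisionRing D]
    [Algebra F D] [Module.Finite F D] : ∃ e : D ⊗[F] D, IsSeparabilityElement F e := by
  have : Finite D := Module.finite_of_finite F
  let := littleWedderburn D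
  exact exists_of_finite_field F D

/-- A matrix algebra over an algebra with a separability element has a separability element. -/
theorem exists_matrix {F D n : Type*} [Field F] [Ring D] [Algebra F D] [Fintype n]
    [DecidableEq n] [Nonempty n] {e : D ⊗[F] D} (he : IsSeparabilityElement F e) :
    ∃ f : Matrix n n D ⊗[F] Matrix n n D, IsSeparabilityElement F f := by
  obtain ⟨k⟩ := ‹Nonempty n›
  let s (i j : n) : D →ₗ[F] Matrix n n D := Matrix.singleLinearMap F i j
  have hs (i j : n) (a : D) : s i j a = Matrix.single i j a := rfl
  refine ⟨∑ i, TensorProduct.map (s i k) (s k i) e, ?_, fun M => ?_⟩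
  · have h (i : n) (z : D ⊗[F] D) : LinearMap.mul' F (Matrix n n D)
        (TensorProduct.map (s i k) (s k i) z) = Matrix.single i i (LinearMap.mul' F D z) := by
      induction z with
      | zero => simp
      | add x y hx hy => simp only [map_add, hx, hy, Matrix.single_add]
      | tmul x y => simp [hs]
    simp only [map_sum, h, he.1]
    exact Matrix.sum_single_one
  · have hl (i j l : n) (a : D) (z : D ⊗[F] D) :
        (Matrix.single i j a ⊗ₜ[F] (1 : Matrix n n D)) * TensorProduct.map (s l k) (s k l) z =
          if j = l then TensorProduct.map (s i k) (s k l) ((a ⊗ₜ 1) * z) else 0 := by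
      induction z with
      | zero => simp
      | add x y hx hy => simp only [map_add, mul_add, hx, hy]; split_ifs <;> simp
      | tmul x y =>
        split_ifs with h
        · subst h; simp [hs]
        · simp [hs, h]
    have hr (i j l : n) (a : D) (z : D ⊗[F] D) :
        TensorProduct.map (s l k) (s k l) z * ((1 : Matrix n n D) ⊗ₜ[F] Matrix.single i j a) =
          if l = i then TensorProduct.map (s l k) (s k j) (z * (1 ⊗ₜ a)) else 0 := by
      induction z with
      | zero => simp
      | add x y hx hy => simp only [map_add, add_mul, hx, hy]; split_ifs <;> simp
      | tmul x y =>
        split_ifs with h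
        · subst h; simp [hs]
        · simp [hs, h]
    induction M using Matrix.induction_on' with
    | h_zero => simp
    | h_add p q hp hq => rw [add_tmul, tmul_add, add_mul, mul_add, hp, hq]
    | h_std_basis i j a =>
      simp [Finset.mul_sum, Finset.sum_mul, hl, hr, he.2]

/-- A finite product of algebras with separability elements has a separability element. -/
theorem exists_pi {F ι : Type*} [Field F] [Fintype ι] [DecidableEq ι] {A : ι → Type*}
    [∀ i, Ring (A i)] [∀ i, Algebra F (A i)]
    (h : ∀ i, ∃ e : A i ⊗[F] A i, IsSeparabilityElement F e) :
    ∃ f : (Π i, A i) ⊗[F] (Π i, A i), IsSeparabilityElement F f := by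
  choose e he using h
  let s (i : ι) : A i →ₗ[F] Π i, A i := LinearMap.single F A i
  have hs (i : ι) (a : A i) : s i a = Pi.single i a := rfl
  refine ⟨∑ i, TensorProduct.map (s i) (s i) (e i), ?_, fun a => ?_⟩
  · have h (i : ι) (z : A i ⊗[F] A i) : LinearMap.mul' F (Π i, A i)
        (TensorProduct.map (s i) (s i) z) = Pi.single i (LinearMap.mul' F (A i) z) := by
      induction z with
      | zero => simp
      | add x y hx hy => simp only [map_add, hx, hy, Pi.single_add]
      | tmul x y => simp [hs, Pi.single_mul]
    simp only [map_sum, h, (he _).1]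
    exact Finset.univ_sum_single 1
  · have hl (i : ι) (z : A i ⊗[F] A i) :
        (a ⊗ₜ[F] (1 : Π i, A i)) * TensorProduct.map (s i) (s i) z =
        TensorProduct.map (s i) (s i) ((a i ⊗ₜ 1) * z) := by
      induction z with
      | zero => simp
      | add x y hx hy => simp only [map_add, mul_add, hx, hy]
      | tmul x y => simp [hs, Pi.single_mul_right]
    have hr (i : ι) (z : A i ⊗[F] A i) :
        TensorProduct.map (s i) (s i) z * ((1 : Π i, A i) ⊗ₜ[F] a) =
        TensorProduct.map (s i) (s i) (z * (1 ⊗ₜ a i)) := by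
      induction z with
      | zero => simp
      | add x y hx hy => simp only [map_add, add_mul, hx, hy]
      | tmul x y => simp [hs, Pi.single_mul_left]
    simp only [Finset.mul_sum, Finset.sum_mul, hl, hr, (he _).2]

/-- A finite semisimple algebra over a finite field has a separability element. -/
theorem exists_of_isSemisimpleRing (F A : Type*) [Field F] [Finite F] [Ring A] [Algebra F A]
    [Module.Finite F A] [IsSemisimpleRing A] : ∃ e : A ⊗[F] A, IsSeparabilityElement F e := by
  obtain ⟨n, D, d, _, _, _, hd, ⟨f⟩⟩ :=
    IsSemisimpleRing.exists_algEquiv_pi_matrix_divisionRing_finite F A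
  obtain ⟨e, he⟩ := exists_pi (F := F) (A := fun i => Matrix (Fin (d i)) (Fin (d i)) (D i))
    fun i => (exists_of_finite_divisionRing F (D i)).elim fun _ he => exists_matrix he
  refine he.exists_of_span_range_eq_top (K := F) f.symm.toAlgHom ?_
  have h : Set.range f.symm.toAlgHom = Set.univ := f.symm.surjective.range_eq
  rw [h, Submodule.span_univ]

end IsSeparabilityElement

/-- If `E` is spanned by products of elements of `φ(A)` with elements of a submonoid commuting with
`φ(A)`, then `φ` maps nilpotent ideals into the Jacobson radical. -/
theorem Ring.map_mem_jacobson_of_isNilpotent {K A E : Type*} [CommRing K] [Ring A] [Ring E]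
    [Algebra K E] (φ : A →+* E) (S : Submonoid E) (hcomm : ∀ a, ∀ s ∈ S, Commute (φ a) s)
    (hspan : Submodule.span K (Set.range φ * (S : Set E)) = ⊤) {I : Ideal A} [I.IsTwoSided]
    (hI : IsNilpotent I) {x : A} (hx : x ∈ I) : φ x ∈ Ring.jacobson E := by
  let N (k : ℕ) : Submodule K E := Submodule.span K (φ '' (I ^ k : Ideal A) * (S : Set E))
  have hN (k l : ℕ) : N k * N l ≤ N (k + l) := by
    rw [Submodule.span_mul_span]
    refine Submodule.span_mono ?_
    rintro _ ⟨_, ⟨_, ⟨a, ha, rfl⟩, s, hs, rfl⟩, _, ⟨_, ⟨b, hb, rfl⟩, t, ht, rfl⟩, rfl⟩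
    refine ⟨φ (a * b), ⟨a * b, ?_, rfl⟩, s * t, S.mul_mem hs ht, ?_⟩
    · rw [Ideal.IsTwoSided.pow_add]
      exact Ideal.mul_mem_mul ha hb
    · simp only [map_mul, mul_assoc, (hcomm b s hs).left_comm]
  have hN0 : N 0 = ⊤ := by
    rw [← hspan]
    simp [N, Submodule.pow_zero]
  have hpow (k : ℕ) : N 1 ^ k ≤ N k := by
    induction k with
    | zero => simp [hN0]
    | succ k ih => exact (pow_succ (N 1) k).trans_le ((mul_le_mul_left ih _).trans (hN k 1))
  obtain ⟨n, hn⟩ := hI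
  have hNn : N n = ⊥ := by
    rw [Submodule.span_eq_bot]
    rintro _ ⟨_, ⟨a, ha, rfl⟩, s, hs, rfl⟩
    rw [hn] at ha
    simp [show a = 0 from ha]
  rw [← Ideal.jacobson_bot, Ideal.mem_jacobson_iff]
  intro c
  have hc : c * φ x ∈ N 1 := by
    refine (zero_add 1 ▸ hN 0 1) (Submodule.mul_mem_mul (hN0 ▸ Submodule.mem_top) ?_)
    exact Submodule.subset_span
      ⟨φ x, ⟨x, by simpa [Submodule.pow_one] using hx, rfl⟩, 1, S.one_mem, mul_one _⟩
  have hnil : IsNilpotent (c * φ x) :=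
    ⟨n, (Submodule.mem_bot K).mp (hNn ▸ hpow n (Submodule.pow_mem_pow _ hc n))⟩
  obtain ⟨u, hu⟩ := hnil.isUnit_add_one
  refine ⟨↑u⁻¹, ?_⟩
  rw [Ideal.mem_bot, mul_assoc, ← mul_add_one, ← hu, Units.inv_mul, sub_self]

/-- Over an extension of a finite field, the group algebra of a finite group is separable
modulo its Jacobson radical, since it is defined over the finite field. -/
theorem IsSeparabilityElement.exists_monoidAlgebra_quotient_jacobson (F K G : Type*) [Field F]
    [Finite F] [Field K] [Algebra F K] [Group G] [Finite G] :
    ∃ e : (MonoidAlgebra K G ⧸ Ring.jacobson (MonoidAlgebra K G)) ⊗[K]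
      (MonoidAlgebra K G ⧸ Ring.jacobson (MonoidAlgebra K G)), IsSeparabilityElement K e := by
  let A := MonoidAlgebra F G
  let E := MonoidAlgebra K G
  let φ : A →ₐ[F] E := MonoidAlgebra.mapAlgHom G (Algebra.ofId F K)
  have hφ : Submodule.span K (Set.range φ) = ⊤ := by
    refine top_unique fun x _ => ?_
    induction x using MonoidAlgebra.induction_linear with
    | zero => simp
    | add f g hf hg => exact add_mem (hf trivial) (hg trivial)
    | single g r =>
      have h : MonoidAlgebra.single g r = r • φ (MonoidAlgebra.single g 1) := by
        change _ = r • MonoidAlgebra.mapAlgHom G (Algebra.ofId F K) _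
        rw [MonoidAlgebra.mapAlgHom_single, map_one, MonoidAlgebra.smul_single, smul_eq_mul,
          mul_one]
      rw [h]
      exact Submodule.smul_mem _ _ (Submodule.subset_span ⟨_, rfl⟩)
  have : IsArtinianRing A := IsArtinianRing.of_finite F A
  let π : E →ₐ[K] E ⧸ Ring.jacobson E := Ideal.Quotient.mkₐ K (Ring.jacobson E)
  let ψ : A →ₐ[F] E ⧸ Ring.jacobson E := (π.restrictScalars F).comp φ
  have hker (a : A) (ha : a ∈ Ring.jacobson A) : ψ a = 0 :=
    Ideal.Quotient.eq_zero_iff_mem.mpr <|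
      Ring.map_mem_jacobson_of_isNilpotent (K := K) φ.toRingHom ⊥ (by simp) (by simpa using hφ)
        IsSemiprimaryRing.isNilpotent ha
  obtain ⟨e, he⟩ := exists_of_isSemisimpleRing F (A ⧸ Ring.jacobson A)
  refine he.exists_of_span_range_eq_top (Ideal.Quotient.liftₐ (Ring.jacobson A) ψ hker)
    (top_unique ?_)
  have hπ : LinearMap.range π.toLinearMap = ⊤ :=
    LinearMap.range_eq_top.mpr Ideal.Quotient.mk_surjective
  rw [← hπ, ← Submodule.map_top, ← hφ, Submodule.map_span]
  refine Submodule.span_mono ?_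
  rintro _ ⟨_, ⟨a, rfl⟩, rfl⟩
  exact ⟨Ideal.Quotient.mk _ a, rfl⟩

theorem TensorProduct.ker_map_le_span {K M N M' N' : Type*} [CommRing K] [AddCommGroup M]
    [AddCommGroup N] [AddCommGroup M'] [AddCommGroup N'] [Module K M] [Module K N] [Module K M']
    [Module K N'] {f : M →ₗ[K] M'} {g : N →ₗ[K] N'} (hf : Function.Surjective f)
    (hg : Function.Surjective g) {S B : Set M} {T C : Set N} (hB : Submodule.span K B = ⊤)
    (hC : Submodule.span K C = ⊤) (hS : LinearMap.ker f = Submodule.span K S)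
    (hT : LinearMap.ker g = Submodule.span K T) :
    LinearMap.ker (TensorProduct.map f g) ≤
      Submodule.span K (Set.image2 (· ⊗ₜ[K] ·) B T ∪ Set.image2 (· ⊗ₜ[K] ·) S C) := by
  have hmem {S : Set M} {T : Set N} {m : M} {n : N} (hm : m ∈ Submodule.span K S)
      (hn : n ∈ Submodule.span K T) :
      m ⊗ₜ[K] n ∈ Submodule.span K (Set.image2 (· ⊗ₜ[K] ·) S T) := by
    have h := Submodule.apply_mem_map₂ (TensorProduct.mk K M N) hm hn
    rwa [Submodule.map₂_span_span] at h
  rw [TensorProduct.map_ker f.exact_subtype_ker_map hf g.exact_subtype_ker_map hg, sup_le_iff]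
  constructor
  · rintro _ ⟨z, rfl⟩
    induction z with
    | zero => simp
    | add x y hx hy => rw [map_add]; exact add_mem hx hy
    | tmul m n =>
      exact Submodule.span_mono Set.subset_union_left
        (hmem (hB ▸ Submodule.mem_top) (hT ▸ n.2))
  · rintro _ ⟨z, rfl⟩
    induction z with
    | zero => simp
    | add x y hx hy => rw [map_add]; exact add_mem hx hy
    | tmul m n =>
      exact Submodule.span_mono Set.subset_union_right
        (hmem (hS ▸ m.2) (hC ▸ Submodule.mem_top))

namespace Ring

theorem ringEquiv_mem_jacobson {R S : Type*} [Ring R] [Ring S] (e : R ≃+* S) {x : R}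
    (hx : x ∈ Ring.jacobson R) : e x ∈ Ring.jacobson S :=
  have : RingHomSurjective (e : R →+* S) := ⟨e.surjective⟩
  Ring.le_comap_jacobson (e : R →+* S) hx

theorem ker_mkₐ_jacobson (K R : Type*) [CommRing K] [Ring R] [Algebra K R] :
    LinearMap.ker (Ideal.Quotient.mkₐ K (Ring.jacobson R)).toLinearMap =
      (Ring.jacobson R).restrictScalars K :=
  Submodule.ext fun _ => Ideal.Quotient.eq_zero_iff_mem

variable {K A C : Type*} [Field K] [Ring A] [Algebra K A] [Module.Finite K A] [Ring C]
  [Algebra K C]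

theorem tmul_mem_jacobson_of_left {a : A} (ha : a ∈ Ring.jacobson A) (c : C) :
    a ⊗ₜ[K] c ∈ Ring.jacobson (A ⊗[K] C) := by
  have : IsArtinianRing A := IsArtinianRing.of_finite K A
  have h : a ⊗ₜ[K] (1 : C) ∈ Ring.jacobson (A ⊗[K] C) := by
    refine Ring.map_mem_jacobson_of_isNilpotent (K := K)
      (Algebra.TensorProduct.includeLeft : A →ₐ[K] A ⊗[K] C).toRingHom
      (MonoidHom.mrange (Algebra.TensorProduct.includeRight : C →ₐ[K] A ⊗[K] C)) ?_ ?_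
      IsSemiprimaryRing.isNilpotent ha
    · rintro x _ ⟨y, rfl⟩
      simp [commute_iff_eq]
    · refine top_unique ((TensorProduct.span_tmul_eq_top K A C).ge.trans (Submodule.span_mono ?_))
      rintro _ ⟨x, y, rfl⟩
      exact ⟨x ⊗ₜ 1, ⟨x, rfl⟩, 1 ⊗ₜ y, ⟨y, rfl⟩, by simp⟩
  simpa using Ideal.mul_mem_right ((1 : A) ⊗ₜ[K] c) _ h

theorem tmul_mem_jacobson_of_right (c : C) {a : A} (ha : a ∈ Ring.jacobson A) :
    c ⊗ₜ[K] a ∈ Ring.jacobson (C ⊗[K] A) :=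
  ringEquiv_mem_jacobson (Algebra.TensorProduct.comm K A C).toRingEquiv
    (tmul_mem_jacobson_of_left ha c)

end Ring

namespace IsFilteredMultiplicativeBasis

theorem map_algEquiv {K A C : Type*} [Field K] [Ring A] [Algebra K A] [Ring C] [Algebra K C]
    {B : Set A} (h : IsFilteredMultiplicativeBasis K B) (e : A ≃ₐ[K] C) :
    IsFilteredMultiplicativeBasis K (e '' B) := by
  obtain ⟨hli, hspan, hmul, -, hrad⟩ := h
  have hli' : LinearIndepOn K id (e '' B) :=
    LinearIndepOn.id_image (v := e) (s := B)
      (hli.map' e.toLinearMap (LinearMap.ker_eq_bot.mpr e.injective))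
  have hjac : e '' ((⊥ : Ideal A).jacobson : Set A) = ((⊥ : Ideal C).jacobson : Set C) := by
    rw [Ideal.jacobson_bot, Ideal.jacobson_bot]
    refine Set.Subset.antisymm ?_ fun x hx => ⟨e.symm x, ?_, e.apply_symm_apply x⟩
    · rintro _ ⟨x, hx, rfl⟩
      exact Ring.ringEquiv_mem_jacobson e.toRingEquiv hx
    · exact Ring.ringEquiv_mem_jacobson e.symm.toRingEquiv hx
  refine ⟨hli', ?_, ?_, hli'.mono Set.inter_subset_left, ?_⟩
  · have h := Submodule.map_span e.toLinearMap B
    rw [hspan, Submodule.map_top, LinearMap.range_eq_top.mpr e.surjective] at h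
    exact h.symm
  · rintro _ ⟨a, ha, rfl⟩ _ ⟨b, hb, rfl⟩
    rw [← map_mul]
    exact (hmul a ha b hb).imp (fun h => by rw [h, map_zero]) (Set.mem_image_of_mem e)
  · rw [← hjac, ← Set.image_inter e.injective]
    refine (Submodule.map_span e.toLinearMap _).symm.trans ?_
    rw [hrad]
    exact SetLike.coe_injective hjac

theorem tensorProduct {K A C : Type*} [Field K] [Ring A] [Algebra K A] [Module.Finite K A]
    [Ring C] [Algebra K C] [Module.Finite K C] {B : Set A} {D : Set C}
    (hB : IsFilteredMultiplicativeBasis K B) (hD : IsFilteredMultiplicativeBasis K D)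
    (hjac : ∀ x ∈ Ring.jacobson (A ⊗[K] C),
      Algebra.TensorProduct.map (Ideal.Quotient.mkₐ K (Ring.jacobson A))
        (Ideal.Quotient.mkₐ K (Ring.jacobson C)) x = 0) :
    IsFilteredMultiplicativeBasis K (Set.image2 (· ⊗ₜ[K] ·) B D) := by
  obtain ⟨hli, hspan, hmul, -, hrad⟩ := hB
  obtain ⟨hli', hspan', hmul', -, hrad'⟩ := hD
  rw [Ideal.jacobson_bot] at hrad hrad'
  have hindep : LinearIndepOn K id (Set.image2 (· ⊗ₜ[K] ·) B D) := by
    rw [← Set.image_prod]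
    exact (LinearIndepOn.tmul_of_isDomain (v := id) (w := id) hli hli').id_image
  refine ⟨hindep, ?_, ?_, hindep.mono Set.inter_subset_left, ?_⟩
  · have h := Submodule.map₂_span_span K (TensorProduct.mk K A C) B D
    rw [hspan, hspan', TensorProduct.map₂_mk_top_top_eq_top] at h
    exact h.symm
  · rintro _ ⟨a, ha, c, hc, rfl⟩ _ ⟨a', ha', c', hc', rfl⟩
    simp only [Algebra.TensorProduct.tmul_mul_tmul]
    rcases hmul a ha a' ha' with h | h
    · simp [h]
    rcases hmul' c hc c' hc' with h' | h'
    · simp [h']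
    exact Or.inr ⟨_, h, _, h', rfl⟩
  · rw [Ideal.jacobson_bot]
    refine le_antisymm (Submodule.span_le.mpr fun x hx => hx.2) fun x hx => ?_
    refine Submodule.span_mono ?_ (TensorProduct.ker_map_le_span
      (f := (Ideal.Quotient.mkₐ K (Ring.jacobson A)).toLinearMap)
      (g := (Ideal.Quotient.mkₐ K (Ring.jacobson C)).toLinearMap)
      Ideal.Quotient.mk_surjective Ideal.Quotient.mk_surjective hspan hspan'
      ((Ring.ker_mkₐ_jacobson K A).trans hrad.symm)
      ((Ring.ker_mkₐ_jacobson K C).trans hrad'.symm) (hjac x hx))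
    rintro _ (⟨a, ha, c, hc, rfl⟩ | ⟨a, ha, c, hc, rfl⟩)
    · exact ⟨⟨a, ha, c, hc.1, rfl⟩, Ring.tmul_mem_jacobson_of_right a hc.2⟩
    · exact ⟨⟨a, ha.1, c, hc, rfl⟩, Ring.tmul_mem_jacobson_of_left ha.2 c⟩

end IsFilteredMultiplicativeBasis

theorem MonoidAlgebra.commute_mapDomainAlgHom_inl_inr {K G H : Type*} [CommSemiring K] [Monoid G]
    [Monoid H] (x : MonoidAlgebra K G) (y : MonoidAlgebra K H) :
    Commute (MonoidAlgebra.mapDomainAlgHom K K (MonoidHom.inl G H) x)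
      (MonoidAlgebra.mapDomainAlgHom K K (MonoidHom.inr G H) y) := by
  induction x using MonoidAlgebra.induction_linear with
  | zero => simp
  | add f g hf hg => rw [map_add]; exact hf.add_left hg
  | single g r =>
    induction y using MonoidAlgebra.induction_linear with
    | zero => simp
    | add f g hf hg => rw [map_add]; exact hf.add_right hg
    | single h s => simp [commute_iff_eq, mul_comm]

/-- The tensor product of two monoid algebras is, as an algebra, the monoid algebra of their
product. -/
noncomputable def MonoidAlgebra.tensorAlgEquiv (K G H : Type*) [CommSemiring K] [Monoid G]
    [Monoid H] : MonoidAlgebra K G ⊗[K] MonoidAlgebra K H ≃ₐ[K] MonoidAlgebra K (G × H) :=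
  AlgEquiv.ofBijective
    (Algebra.TensorProduct.lift (MonoidAlgebra.mapDomainAlgHom K K (MonoidHom.inl G H))
      (MonoidAlgebra.mapDomainAlgHom K K (MonoidHom.inr G H))
      MonoidAlgebra.commute_mapDomainAlgHom_inl_inr) <| by
    convert! (MonoidAlgebra.tensorEquiv (M := G) (N := H) K).bijective using 1
    refine funext fun z => ?_
    induction z with
    | zero => simp
    | add x y hx hy => simp only [map_add, hx, hy]
    | tmul x y =>
      induction x using MonoidAlgebra.induction_linear with
      | zero => simp
      | add f g hf hg => simp only [add_tmul, map_add, hf, hg]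
      | single g r =>
        induction y using MonoidAlgebra.induction_linear with
        | zero => simp
        | add f g hf hg => simp only [tmul_add, map_add, hf, hg]
        | single h s => simp

theorem MonoidAlgebra.tensorAlgEquiv_tmul {K G H : Type*} [CommSemiring K] [Monoid G]
    [Monoid H] (x : MonoidAlgebra K G) (y : MonoidAlgebra K H) :
    MonoidAlgebra.tensorAlgEquiv K G H (x ⊗ₜ y) =
      MonoidAlgebra.mapDomainAlgHom K K (MonoidHom.inl G H) x *
        MonoidAlgebra.mapDomainAlgHom K K (MonoidHom.inr G H) y :=
  Algebra.TensorProduct.lift_tmul _ _ MonoidAlgebra.commute_mapDomainAlgHom_inl_inr x y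

theorem MonoidAlgebra.map_mk_eq_zero_of_mem_jacobson_tensorProduct {K G H : Type*} [Field K]
    [Group G] [Group H] [Finite G] [Finite H] {x : MonoidAlgebra K G ⊗[K] MonoidAlgebra K H}
    (hx : x ∈ Ring.jacobson (MonoidAlgebra K G ⊗[K] MonoidAlgebra K H)) :
    Algebra.TensorProduct.map (Ideal.Quotient.mkₐ K (Ring.jacobson (MonoidAlgebra K G)))
      (Ideal.Quotient.mkₐ K (Ring.jacobson (MonoidAlgebra K H))) x = 0 := by
  obtain ⟨p, _⟩ := CharP.exists K
  rcases CharP.char_is_prime_or_zero K p with hp | rfl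
  · have : Fact p.Prime := ⟨hp⟩
    let := ZMod.algebra K p
    obtain ⟨e, he⟩ :=
      IsSeparabilityElement.exists_monoidAlgebra_quotient_jacobson (ZMod p) K G
    obtain ⟨f, hf⟩ :=
      IsSeparabilityElement.exists_monoidAlgebra_quotient_jacobson (ZMod p) K H
    obtain ⟨g, hg⟩ := he.exists_tensorProduct hf
    have := hg.isSemisimpleRing
    let π := (Algebra.TensorProduct.map
      (Ideal.Quotient.mkₐ K (Ring.jacobson (MonoidAlgebra K G)))
      (Ideal.Quotient.mkₐ K (Ring.jacobson (MonoidAlgebra K H)))).toRingHom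
    have : RingHomSurjective π :=
      ⟨TensorProduct.map_surjective Ideal.Quotient.mk_surjective Ideal.Quotient.mk_surjective⟩
    have h : π x ∈ Ring.jacobson _ := Ring.le_comap_jacobson π hx
    exact (Submodule.mem_bot _).mp ((IsSemisimpleRing.jacobson_eq_bot _).le h)
  · have : CharZero K := CharP.charP_to_charZero K
    have : NeZero (Nat.card (G × H) : K) := ⟨Nat.cast_ne_zero.mpr Nat.card_pos.ne'⟩
    have := (MonoidAlgebra.tensorAlgEquiv K G H).symm.toRingEquiv.isSemisimpleRing
    rw [IsSemisimpleRing.jacobson_eq_bot, Ideal.mem_bot] at hx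
    rw [hx, map_zero]

end

/-- If `B₁` and `B₂` are filtered multiplicative `K`-bases of `KG₁` and `KG₂`
respectively, then `{b₁ * b₂ : b₁ ∈ B₁, b₂ ∈ B₂}` (with `B₁, B₂` viewed inside
`K[G₁ × G₂]` via the canonical embeddings) is a filtered multiplicative `K`-basis
of `K[G₁ × G₂]`. -/
theorem filtered_mult_basis_prod (K : Type*) [Field K]
    (G₁ G₂ : Type*) [Group G₁] [Group G₂] [Fintype G₁] [Fintype G₂]
    (B₁ : Set (MonoidAlgebra K G₁)) (B₂ : Set (MonoidAlgebra K G₂))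
    (h₁ : IsFilteredMultiplicativeBasis K B₁)
    (h₂ : IsFilteredMultiplicativeBasis K B₂) :
    IsFilteredMultiplicativeBasis K
      { x : MonoidAlgebra K (G₁ × G₂) | ∃ b₁ ∈ B₁, ∃ b₂ ∈ B₂,
          x = MonoidAlgebra.mapDomainAlgHom K K (MonoidHom.inl G₁ G₂) b₁ *
              MonoidAlgebra.mapDomainAlgHom K K (MonoidHom.inr G₁ G₂) b₂ } := by
  convert (h₁.tensorProduct h₂ fun _ =>
    MonoidAlgebra.map_mk_eq_zero_of_mem_jacobson_tensorProduct).map_algEquiv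
      (MonoidAlgebra.tensorAlgEquiv K G₁ G₂) using 1
  ext x
  constructor
  · rintro ⟨b₁, hb₁, b₂, hb₂, rfl⟩
    exact ⟨_, ⟨b₁, hb₁, b₂, hb₂, rfl⟩, MonoidAlgebra.tensorAlgEquiv_tmul b₁ b₂⟩
  · rintro ⟨_, ⟨b₁, hb₁, b₂, hb₂, rfl⟩, rfl⟩
    exact ⟨b₁, hb₁, b₂, hb₂, MonoidAlgebra.tensorAlgEquiv_tmul b₁ b₂⟩
end

section
/- Let A be a finite-dimensional algebra over a field K and let B be a filtered multiplicative K-basis of A. Then for every integer n >= 1, the intersection of B with rad(A)^n is a K-basis of rad(A)^n. -/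
/-- Products of left ideals spanned by parts of a multiplicatively closed-up-to-zero set `B`
are again spanned by the elements of `B` they contain. -/
theorem Ideal.span_inter_mul_eq (K : Type*) {A : Type*} [Field K] [Ring A] [Algebra K A]
    {B : Set A} (hmul : ∀ b₁ ∈ B, ∀ b₂ ∈ B, b₁ * b₂ = 0 ∨ b₁ * b₂ ∈ B) {I J : Ideal A}
    (hI : Submodule.span K (B ∩ (I : Set A)) = Submodule.restrictScalars K I)
    (hJ : Submodule.span K (B ∩ (J : Set A)) = Submodule.restrictScalars K J) :
    Submodule.span K (B ∩ ((I * J : Ideal A) : Set A)) =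
      Submodule.restrictScalars K (I * J) := by
  apply le_antisymm
  · exact Submodule.span_le.2 fun x hx => hx.2
  · intro z hz
    rw [Submodule.restrictScalars_mem] at hz
    refine Submodule.mul_induction_on (C := fun z =>
      z ∈ Submodule.span K (B ∩ ((I * J : Ideal A) : Set A))) hz ?_
      fun x y hx hy => Submodule.add_mem _ hx hy
    intro x hx y hy
    have hx' : x ∈ Submodule.span K (B ∩ (I : Set A)) := hI ▸ hx
    have hy' : y ∈ Submodule.span K (B ∩ (J : Set A)) := hJ ▸ hy
    have hxy := Submodule.mul_mem_mul hx' hy'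
    rw [Submodule.span_mul_span] at hxy
    refine Submodule.span_le.2 ?_ hxy
    rintro _ ⟨a, ha, b, hb, rfl⟩
    rcases hmul a ha.1 b hb.1 with h | h
    · simp [h]
    · exact Submodule.subset_span ⟨h, Submodule.mul_mem_mul ha.2 hb.2⟩


/-- Property (I): if `B` is a filtered multiplicative `K`-basis of a
finite-dimensional `K`-algebra `A`, then `B ∩ rad(A)ⁿ` is a `K`-basis of `rad(A)ⁿ`
for all `n ≥ 1`. -/
theorem filtered_mult_basis_inter_rad_pow (K A : Type*) [Field K] [Ring A] [Algebra K A]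
    [FiniteDimensional K A]
    (B : Set A) (hB : IsFilteredMultiplicativeBasis K B) (n : ℕ) (hn : 1 ≤ n) :
    LinearIndependent K
      ((↑) : ↥(B ∩ (((⊥ : Ideal A).jacobson ^ n : Ideal A) : Set A)) → A) ∧
    Submodule.span K (B ∩ (((⊥ : Ideal A).jacobson ^ n : Ideal A) : Set A)) =
      Submodule.restrictScalars K ((⊥ : Ideal A).jacobson ^ n) := by
  obtain ⟨hli, -, hmul, -, hrad⟩ := hB
  refine ⟨LinearIndepOn.mono (v := id) hli Set.inter_subset_left, ?_⟩
  induction n, hn using Nat.le_induction with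
  | base => simpa only [Submodule.pow_one] using hrad
  | succ n hn ih =>
    rw [Submodule.pow_succ]
    exact Ideal.span_inter_mul_eq K hmul ih hrad
end

section
/- Let A be a finite-dimensional algebra over a field K, let B be a filtered multiplicative K-basis of A, and let k >= 1 be an integer. If u and v are elements of B not lying in rad(A)^k and u - v lies in rad(A)^k, then u = v. -/
/-- A positive power of the radical is spanned by the elements of a filtered multiplicative basis
that it contains. -/
theorem IsFilteredMultiplicativeBasis.mem_span_inter_jacobson_pow {K A : Type*} [Field K] [Ring A]
    [Algebra K A] {B : Set A} (hB : IsFilteredMultiplicativeBasis K B) {k : ℕ} (hk : 1 ≤ k)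
    {x : A} (hx : x ∈ ((⊥ : Ideal A).jacobson ^ k : Ideal A)) :
    x ∈ Submodule.span K (B ∩ (((⊥ : Ideal A).jacobson ^ k : Ideal A) : Set A)) := by
  obtain ⟨-, -, hmul, -, hrad⟩ := hB
  have hJ : ∀ y ∈ (⊥ : Ideal A).jacobson,
      y ∈ Submodule.span K (B ∩ (((⊥ : Ideal A).jacobson : Ideal A) : Set A)) := fun y hy => by
    rw [hrad]
    exact hy
  induction k, hk using Nat.le_induction generalizing x with
  | base =>
    rw [Submodule.pow_one] at hx ⊢
    exact hJ x hx
  | succ n _ ih =>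
    rw [Submodule.pow_succ] at hx ⊢
    refine Submodule.smul_induction_on hx (fun a ha b hb => ?_) fun _ _ => Submodule.add_mem _
    have hab := Submodule.mul_mem_mul (ih ha) (hJ b hb)
    rw [Submodule.span_mul_span] at hab
    refine Submodule.span_le.2 ?_ hab
    rintro _ ⟨c, ⟨hcB, hc⟩, d, ⟨hdB, hd⟩, rfl⟩
    rcases hmul c hcB d hdB with h | h
    · simp [h]
    · exact Submodule.subset_span ⟨h, Ideal.mul_mem_mul hc hd⟩

/-- Property (II): if `B` is a filtered multiplicative `K`-basis of a
finite-dimensional `K`-algebra `A`, `k ≥ 1`, and `u, v ∈ B` do not lie in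
`rad(A)ᵏ` while `u - v ∈ rad(A)ᵏ`, then `u = v`. -/
theorem filtered_mult_basis_congr_mod_rad_pow (K A : Type*) [Field K] [Ring A] [Algebra K A]
    [FiniteDimensional K A]
    (B : Set A) (hB : IsFilteredMultiplicativeBasis K B) (k : ℕ) (hk : 1 ≤ k)
    (u v : A) (hu : u ∈ B) (hv : v ∈ B)
    (hu' : u ∉ ((⊥ : Ideal A).jacobson ^ k : Ideal A))
    (hv' : v ∉ ((⊥ : Ideal A).jacobson ^ k : Ideal A))
    (huv : u - v ∈ ((⊥ : Ideal A).jacobson ^ k : Ideal A)) :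
    u = v := by
  by_contra hne
  have hspan := hB.mem_span_inter_jacobson_pow hk huv
  have hsub : insert v (B ∩ (((⊥ : Ideal A).jacobson ^ k : Ideal A) : Set A)) ⊆ B :=
    Set.insert_subset hv Set.inter_subset_left
  have hmem : u ∈ Submodule.span K
      (insert v (B ∩ (((⊥ : Ideal A).jacobson ^ k : Ideal A) : Set A))) :=
    Submodule.mem_span_insert.2 ⟨1, u - v, hspan, by simp⟩
  have hli : LinearIndepOn K id B := hB.1
  have hu_mem := ((hli.mono hsub).mem_span_iff_id).1 hmem
    (hli.mono (Set.insert_subset hu hsub))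
  rcases hu_mem with h | h
  · exact hne h
  · exact hu' h.2
end
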